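/- Let F be an algebraically closed field of characteristic zero and n ≥ 2. Then the Jordan superalgebra Q(n) cannot be written as A + B for two proper nontrivial simple subsuperalgebras A and B. -/

import Mathlib

open Matrix

namespace SJ

section SuperDefs

variable {F : Type*} [Field F] {J : Type*} [AddCommGroup J] [Module F J]

/-- A graded subspace: `A = (A ∩ J₀) ⊕ (A ∩ J₁)`. -/
def IsGradedG (ev od : Submodule F J) (A : Submodule F J) : Prop :=
  A = (A ⊓ ev) ⊔ (A ⊓ od)

/-- A subsuperalgebra: a graded subspace closed under the product. -/
def IsSubalgG (mul : J → J → J) (ev od : Submodule F J) (A : Submodule F J) : Prop :=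
  IsGradedG ev od A ∧ ∀ x ∈ A, ∀ y ∈ A, mul x y ∈ A

/-- Nontrivial: `A ∩ J₁ ≠ {0}`. -/
def NontrivG (od : Submodule F J) (A : Submodule F J) : Prop := A ⊓ od ≠ ⊥

/-- Simple: `A∘A ≠ 0` and the only graded subspaces `I ⊆ A` with `A∘I ⊆ I` are `0` and `A`. -/
def IsSimpleG (mul : J → J → J) (ev od : Submodule F J) (A : Submodule F J) : Prop :=
  (∃ x ∈ A, ∃ y ∈ A, mul x y ≠ 0) ∧
  ∀ I : Submodule F J, I ≤ A → IsGradedG ev od I →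
    (∀ x ∈ A, ∀ y ∈ I, mul x y ∈ I) → I = ⊥ ∨ I = A

/-- An isomorphism of superalgebras: an F-linear bijection mapping even part onto even
part, odd part onto odd part, and preserving the product. -/
def SuperIsoG {J₂ : Type*} [AddCommGroup J₂] [Module F J₂]
    (mul₁ : J → J → J) (ev₁ od₁ : Submodule F J)
    (mul₂ : J₂ → J₂ → J₂) (ev₂ od₂ : Submodule F J₂)
    (A : Submodule F J) (B : Submodule F J₂) : Prop :=
  ∃ e : A ≃ₗ[F] B,
    (∀ x : A, (x : J) ∈ ev₁ ↔ (e x : J₂) ∈ ev₂) ∧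
    (∀ x : A, (x : J) ∈ od₁ ↔ (e x : J₂) ∈ od₂) ∧
    ∀ x y z : A, mul₁ x y = (z : J) → mul₂ (e x) (e y) = (e z : J₂)

end SuperDefs

/-- The space of (n+m)×(n+m) matrices, indices split into even (`inl`) and odd (`inr`) ones. -/
abbrev MJ (F : Type*) [Field F] (n m : ℕ) :=
  Matrix (Fin n ⊕ Fin m) (Fin n ⊕ Fin m) F

/-- Parity of an index. -/
def pty {n m : ℕ} : Fin n ⊕ Fin m → Bool := Sum.elim (fun _ => false) (fun _ => true)

variable (F : Type*) [Field F]

/-- The odd component of a matrix (block-antidiagonal part). -/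
def oddPart {n m : ℕ} (X : MJ F n m) : MJ F n m :=
  Matrix.of fun i j => if pty i = pty j then 0 else X i j

/-- The even component of a matrix (block-diagonal part). -/
def evenPart {n m : ℕ} (X : MJ F n m) : MJ F n m :=
  Matrix.of fun i j => if pty i = pty j then X i j else 0

variable {F}

/-- The super-Jordan product on `M_{n,m}(F)^{(+)}`:  `x∘y = (xy+yx)/2` when `x` or `y` is
even and `x∘y = (xy−yx)/2` when both are odd, extended bilinearly.  (For arbitrary
matrices this bilinear extension equals `(xy+yx)/2 − y₁x₁` where `x₁, y₁` are the odd
components.) -/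
def jmul {n m : ℕ} (X Y : MJ F n m) : MJ F n m :=
  (2 : F)⁻¹ • (X * Y + Y * X) - oddPart F Y * oddPart F X

variable (F)

/-- The even part `J₀` of `M_{n,m}(F)^{(+)}`: block-diagonal matrices. -/
def evenSub (n m : ℕ) : Submodule F (MJ F n m) where
  carrier := {X | ∀ i j, pty i ≠ pty j → X i j = 0}
  zero_mem' := by intro i j _; simp
  add_mem' := by
    intro a b ha hb i j h
    simp only [Matrix.add_apply, ha i j h, hb i j h, add_zero]
  smul_mem' := by
    intro c a ha i j h
    simp only [Matrix.smul_apply, ha i j h, smul_zero]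

/-- The odd part `J₁` of `M_{n,m}(F)^{(+)}`: block-antidiagonal matrices. -/
def oddSub (n m : ℕ) : Submodule F (MJ F n m) where
  carrier := {X | ∀ i j, pty i = pty j → X i j = 0}
  zero_mem' := by intro i j _; simp
  add_mem' := by
    intro a b ha hb i j h
    simp only [Matrix.add_apply, ha i j h, hb i j h, add_zero]
  smul_mem' := by
    intro c a ha i j h
    simp only [Matrix.smul_apply, ha i j h, smul_zero]

/-- Statements about `M_{n,m}(F)^{(+)}` specialized from the generic definitions. -/
abbrev IsGraded {n m : ℕ} (A : Submodule F (MJ F n m)) : Prop :=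
  IsGradedG (evenSub F n m) (oddSub F n m) A

abbrev IsSubalg {n m : ℕ} (A : Submodule F (MJ F n m)) : Prop :=
  IsSubalgG jmul (evenSub F n m) (oddSub F n m) A

abbrev Nontriv {n m : ℕ} (A : Submodule F (MJ F n m)) : Prop :=
  NontrivG (oddSub F n m) A

abbrev IsSimple {n m : ℕ} (A : Submodule F (MJ F n m)) : Prop :=
  IsSimpleG jmul (evenSub F n m) (oddSub F n m) A

abbrev SuperIso {n₁ m₁ n₂ m₂ : ℕ}
    (A : Submodule F (MJ F n₁ m₁)) (B : Submodule F (MJ F n₂ m₂)) : Prop :=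
  SuperIsoG jmul (evenSub F n₁ m₁) (oddSub F n₁ m₁)
    jmul (evenSub F n₂ m₂) (oddSub F n₂ m₂) A B

/-- The standard symplectic matrix `S = [[0, I_q],[−I_q, 0]]` of size `2q`. -/
def SMat (q : ℕ) : Matrix (Fin (2 * q)) (Fin (2 * q)) F :=
  Matrix.of fun i j =>
    if (j : ℕ) = (i : ℕ) + q then (1 : F) else if (i : ℕ) = (j : ℕ) + q then -1 else 0

/-- `osp(p,q)`: block matrices `[[A, C],[S⁻¹Cᵀ, D]]` inside `M_{p,2q}(F)^{(+)}` with
`A` symmetric, `C` arbitrary and `Dᵀ S = S D`.  The condition on the lower-left block is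
recorded in the equivalent form `S · C₂₁ = C₁₂ᵀ`. -/
def ospSub (p q : ℕ) : Submodule F (MJ F p (2 * q)) where
  carrier := {X | (X.toBlocks₁₁)ᵀ = X.toBlocks₁₁ ∧
    SMat F q * X.toBlocks₂₁ = (X.toBlocks₁₂)ᵀ ∧
    (X.toBlocks₂₂)ᵀ * SMat F q = SMat F q * X.toBlocks₂₂}
  zero_mem' := by
    refine ⟨?_, ?_, ?_⟩ <;> ext i j <;>
      simp [Matrix.toBlocks₁₁, Matrix.toBlocks₁₂, Matrix.toBlocks₂₁, Matrix.toBlocks₂₂,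
        Matrix.mul_apply]
  add_mem' := by
    rintro a b ⟨ha1, ha2, ha3⟩ ⟨hb1, hb2, hb3⟩
    have e11 : (a + b).toBlocks₁₁ = a.toBlocks₁₁ + b.toBlocks₁₁ := rfl
    have e12 : (a + b).toBlocks₁₂ = a.toBlocks₁₂ + b.toBlocks₁₂ := rfl
    have e21 : (a + b).toBlocks₂₁ = a.toBlocks₂₁ + b.toBlocks₂₁ := rfl
    have e22 : (a + b).toBlocks₂₂ = a.toBlocks₂₂ + b.toBlocks₂₂ := rfl
    refine ⟨?_, ?_, ?_⟩
    · rw [e11, Matrix.transpose_add, ha1, hb1]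
    · rw [e21, e12, Matrix.mul_add, Matrix.transpose_add, ha2, hb2]
    · rw [e22, Matrix.transpose_add, Matrix.add_mul, Matrix.mul_add, ha3, hb3]
  smul_mem' := by
    rintro c a ⟨ha1, ha2, ha3⟩
    have e11 : (c • a).toBlocks₁₁ = c • a.toBlocks₁₁ := rfl
    have e12 : (c • a).toBlocks₁₂ = c • a.toBlocks₁₂ := rfl
    have e21 : (c • a).toBlocks₂₁ = c • a.toBlocks₂₁ := rfl
    have e22 : (c • a).toBlocks₂₂ = c • a.toBlocks₂₂ := rfl
    refine ⟨?_, ?_, ?_⟩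
    · rw [e11, Matrix.transpose_smul, ha1]
    · rw [e21, e12, Matrix.mul_smul, Matrix.transpose_smul, ha2]
    · rw [e22, Matrix.transpose_smul, Matrix.smul_mul, Matrix.mul_smul, ha3]

/-- `Q(n)`: matrices `[[A, B],[B, A]]` inside `M_{n,n}(F)^{(+)}`. -/
def QSub (n : ℕ) : Submodule F (MJ F n n) where
  carrier := {X | (∀ i j, X (Sum.inr i) (Sum.inr j) = X (Sum.inl i) (Sum.inl j)) ∧
    (∀ i j, X (Sum.inr i) (Sum.inl j) = X (Sum.inl i) (Sum.inr j))}
  zero_mem' := by constructor <;> intro i j <;> simp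
  add_mem' := by
    rintro a b ⟨ha1, ha2⟩ ⟨hb1, hb2⟩
    constructor <;> intro i j <;>
      simp only [Matrix.add_apply, ha1 i j, ha2 i j, hb1 i j, hb2 i j]
  smul_mem' := by
    rintro c a ⟨ha1, ha2⟩
    constructor <;> intro i j <;>
      simp only [Matrix.smul_apply, ha1 i j, ha2 i j]

/-- `P(n)`: matrices `[[A, B],[C, Aᵀ]]` with `B` symmetric and `C` skew-symmetric,
inside `M_{n,n}(F)^{(+)}`. -/
def PSub (n : ℕ) : Submodule F (MJ F n n) where
  carrier := {X | (∀ i j, X (Sum.inr i) (Sum.inr j) = X (Sum.inl j) (Sum.inl i)) ∧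
    (∀ i j, X (Sum.inl i) (Sum.inr j) = X (Sum.inl j) (Sum.inr i)) ∧
    (∀ i j, X (Sum.inr i) (Sum.inl j) = - X (Sum.inr j) (Sum.inl i))}
  zero_mem' := by refine ⟨?_, ?_, ?_⟩ <;> intro i j <;> simp
  add_mem' := by
    rintro a b ⟨ha1, ha2, ha3⟩ ⟨hb1, hb2, hb3⟩
    refine ⟨?_, ?_, ?_⟩ <;> intro i j <;>
      simp only [Matrix.add_apply, ha1 i j, ha2 i j, ha3 i j, hb1 i j, hb2 i j, hb3 i j] <;>
      ring
  smul_mem' := by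
    rintro c a ⟨ha1, ha2, ha3⟩
    refine ⟨?_, ?_, ?_⟩ <;> intro i j <;>
      simp only [Matrix.smul_apply, ha1 i j, ha2 i j, ha3 i j, smul_neg]


set_option linter.unusedSectionVars false

section Abs
variable {K V : Type*} [Field K] [AddCommGroup V] [Module K V] [FiniteDimensional K V]

/-- the trace -/
noncomputable abbrev τ : Module.End K V →ₗ[K] K := LinearMap.trace K V

lemma τ_comm (a b : Module.End K V) : τ (a * b) = τ (b * a) := LinearMap.trace_mul_comm K a b

lemma τ_rank1 (a : Module.End K V) (l : Module.Dual K V) (v : V) :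
    τ (a * (l.smulRight v)) = l (a v) := by
  have : a * (l.smulRight v) = l.smulRight (a v) := by
    ext x; simp
  rw [this]; simp [τ]

lemma τ_nondeg (a : Module.End K V) (h : ∀ b, τ (a * b) = 0) : a = 0 := by
  ext v
  rw [LinearMap.zero_apply, ← Module.forall_dual_apply_eq_zero_iff K]
  intro l
  rw [← τ_rank1, h]

lemma nil_of_trace [CharZero K] (r : Module.End K V) (h : ∀ k, τ (r ^ (k + 2)) = 0) :
    IsNilpotent r := by
  classical
  have hint : IsIntegral K r := Algebra.IsIntegral.isIntegral r
  have hp : minpoly K r ≠ 0 := minpoly.ne_zero hint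
  obtain ⟨q, hq, hnd⟩ := Polynomial.exists_eq_pow_rootMultiplicity_mul_and_not_dvd
    (minpoly K r) hp 0
  set k := Polynomial.rootMultiplicity 0 (minpoly K r)
  rw [map_zero, sub_zero] at hq hnd
  have hc : IsCoprime (Polynomial.X ^ (k+2) : Polynomial K) q := by
    apply IsCoprime.pow_left
    exact (Polynomial.prime_X.irreducible.coprime_iff_not_dvd).2 hnd
  obtain ⟨a, b, hab⟩ := hc
  have h0 : Polynomial.aeval r (Polynomial.X ^ k * q) = 0 := by
    rw [← hq]; exact minpoly.aeval K r
  have ht : ∀ a : Polynomial K, τ (Polynomial.aeval r (a * Polynomial.X ^ (k+2))) = 0 := by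
    intro a
    induction a using Polynomial.induction_on' with
    | add p q hp hq => rw [add_mul, map_add, map_add, hp, hq, add_zero]
    | monomial m c =>
      have : Polynomial.aeval r ((Polynomial.monomial m) c * Polynomial.X ^ (k + 2)) =
          c • r ^ ((m + k) + 2) := by
        rw [Polynomial.monomial_mul_X_pow, Polynomial.aeval_monomial, Algebra.smul_def]
        simp [add_assoc]
      rw [this, map_smul, h, smul_zero]
  set e := Polynomial.aeval r (a * Polynomial.X ^ (k+2)) with he
  have hbq : Polynomial.aeval r (b * q) = 1 - e := by
    rw [he, eq_sub_iff_add_eq', ← map_add, hab, map_one]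
  have hz : Polynomial.aeval r (a * Polynomial.X ^ (k+2)) * Polynomial.aeval r (b * q) = 0 := by
    rw [← map_mul]
    have : a * Polynomial.X ^ (k+2) * (b * q) = a * b * (Polynomial.X ^ 2 : Polynomial K) * (Polynomial.X ^ k * q) := by
      ring
    rw [this, map_mul, h0, mul_zero]
  have hid : IsIdempotentElem e := by
    rw [hbq, ← he, mul_sub, mul_one, sub_eq_zero] at hz
    exact hz.symm
  have he0 : e = 0 := LinearMap.IsIdempotentElem.eq_zero_of_trace_eq_zero hid (ht a)
  refine ⟨k, ?_⟩
  have h2 : Polynomial.aeval r (Polynomial.X ^ k : Polynomial K) * Polynomial.aeval r (b * q) = 0 := by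
    rw [← map_mul]
    have : (Polynomial.X ^ k : Polynomial K) * (b * q) = b * (Polynomial.X ^ k * q) := by ring
    rw [this, map_mul, h0, mul_zero]
  rw [hbq, he0] at h2
  simpa using h2

end Abs

section Abs
variable {K V : Type*} [Field K] [AddCommGroup V] [Module K V] [FiniteDimensional K V]

/-- Engel-type property -/
def NilAct (T : Submodule K (Module.End K V)) : Prop :=
  ∀ W2 W : Submodule K V, W2 < W → (∀ t ∈ T, ∀ w ∈ W, t w ∈ W) → (∀ t ∈ T, ∀ w ∈ W2, t w ∈ W2) →
    ∃ w ∈ W, w ∉ W2 ∧ ∀ t ∈ T, t w ∈ W2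

lemma nil_step (r : Module.End K V) (hr : IsNilpotent r) (W2 : Submodule K V) (z : V)
    (Z : Submodule K V) (hZ : ∀ w ∈ Z, r w ∈ Z) (hz : z ∈ Z) (hz2 : z ∉ W2) :
    ∃ w ∈ Z, w ∉ W2 ∧ r w ∈ W2 := by
  classical
  obtain ⟨N, hN⟩ := hr
  have hex : ∃ k, (r ^ k) z ∈ W2 := ⟨N, by rw [hN]; simp⟩
  have hpw : ∀ k, (r ^ k) z ∈ Z := by
    intro k
    induction k with
    | zero => simpa
    | succ k ih => rw [pow_succ']; exact hZ _ ih
  have h0 : Nat.find hex ≠ 0 := by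
    intro h
    have := Nat.find_spec hex
    rw [h] at this; exact hz2 (by simpa using this)
  obtain ⟨m, hm⟩ := Nat.exists_eq_succ_of_ne_zero h0
  refine ⟨(r ^ m) z, hpw m, Nat.find_min hex (by omega), ?_⟩
  have := Nat.find_spec hex
  rw [hm, Nat.succ_eq_add_one, pow_succ'] at this
  exact this

/-- flag -/
def flagU (T : Submodule K (Module.End K V)) : ℕ → Submodule K V
  | 0 => ⊥
  | k + 1 =>
    { carrier := {x | ∀ t ∈ T, t x ∈ flagU T k}
      zero_mem' := by intro t _; simp
      add_mem' := by intro a b ha hb t ht; rw [map_add]; exact add_mem (ha t ht) (hb t ht)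
      smul_mem' := by intro c a ha t ht; rw [map_smul]; exact Submodule.smul_mem _ _ (ha t ht) }

lemma flagU_mono (T : Submodule K (Module.End K V)) (k : ℕ) : flagU T k ≤ flagU T (k + 1) := by
  induction k with
  | zero => exact bot_le
  | succ k ih => intro x hx t ht; exact ih (hx t ht)

lemma flagU_top (T : Submodule K (Module.End K V)) (hT : NilAct T) :
    ∃ N, ∀ k, N ≤ k → flagU T k = ⊤ := by
  have key : ∀ k, k ≤ Module.finrank K (flagU T k) ∨ flagU T k = ⊤ := by
    intro k
    induction k with
    | zero => left; simp
    | succ k ih =>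
      by_cases htop : flagU T k = ⊤
      · right; exact top_le_iff.1 (htop ▸ flagU_mono T k)
      · left
        have ih := ih.resolve_right htop
        have hlt : flagU T k < flagU T (k+1) := by
          obtain ⟨w, _, hw, hw2⟩ := hT (flagU T k) ⊤ (lt_top_iff_ne_top.2 htop)
            (fun _ _ _ _ => trivial) (fun t ht w hw => flagU_mono T k hw t ht)
          exact lt_of_le_of_ne (flagU_mono T k) (fun h => hw (h ▸ hw2))
        have := Submodule.finrank_lt_finrank_of_lt hlt
        omega
  refine ⟨Module.finrank K V + 1, fun k hk => ?_⟩
  rcases key k with h | h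
  · have := Submodule.finrank_le (flagU T k)
    omega
  · exact h

/-- filtration on endomorphisms -/
def filG (T : Submodule K (Module.End K V)) (N m : ℕ) : Submodule K (Module.End K V) where
  carrier := {x | ∀ k, ∀ v ∈ flagU T k, x v ∈ flagU T (k + N - m)}
  zero_mem' := by intro k v _; simp
  add_mem' := by intro a b ha hb k v hv; exact add_mem (ha k v hv) (hb k v hv)
  smul_mem' := by intro c a ha k v hv; exact Submodule.smul_mem _ _ (ha k v hv)

lemma flagU_apply (T : Submodule K (Module.End K V)) (t) (ht : t ∈ T) (k : ℕ) (v : V)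
    (hv : v ∈ flagU T k) : t v ∈ flagU T (k - 1) := by
  cases k with
  | zero => have : v = 0 := hv
            rw [this, map_zero]; exact zero_mem _
  | succ k => exact hv t ht

lemma filG_step (T : Submodule K (Module.End K V)) (N m : ℕ) (t x) (ht : t ∈ T)
    (hx : x ∈ filG T N m) : t * x + x * t ∈ filG T N (m+1) := by
  intro k v hv
  refine add_mem ?_ ?_
  · have := flagU_apply T t ht _ _ (hx k v hv)
    rwa [Nat.sub_sub] at this
  · cases k with
    | zero =>
      have : v = 0 := hv
      rw [this, map_zero]; exact zero_mem _
    | succ k =>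
      have := hx k _ (hv t ht)
      rwa [show k + 1 + N - (m+1) = k + N - m by omega]

theorem engel (R : Submodule K (Module.End K V)) (hnil : ∀ r ∈ R, IsNilpotent r)
    (hR : ∀ a ∈ R, ∀ b ∈ R, a * b + b * a ∈ R) : NilAct R := by
  classical
  have main : ∀ d, ∀ T : Submodule K (Module.End K V), T ≤ R → NilAct T →
      Module.finrank K R - Module.finrank K T = d → NilAct R := by
    intro d
    induction d using Nat.strong_induction_on with
    | _ d ih =>
      intro T hTR hT hd
      by_cases hne : R ≤ T
      · rwa [le_antisymm hne hTR]
      obtain ⟨N, hN⟩ := flagU_top T hT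
      have hex : ∃ m, filG T N m ⊓ R ≤ T := by
        refine ⟨2 * N, ?_⟩
        rintro x ⟨hx, -⟩
        have : x = 0 := by
          ext v
          have h1 := hx N v (by rw [hN N le_rfl]; trivial)
          rw [show N + N - 2 * N = 0 by omega] at h1
          exact h1
        rw [this]; exact zero_mem _
      have h0 : Nat.find hex ≠ 0 := by
        intro h
        have h1 := Nat.find_spec hex
        rw [h] at h1
        apply hne
        intro x hx
        refine h1 ⟨fun k v _ => ?_, hx⟩
        rw [hN _ (by omega)]; trivial
      obtain ⟨m, hm⟩ := Nat.exists_eq_succ_of_ne_zero h0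
      have h1 := Nat.find_spec hex
      rw [hm] at h1
      have h2 := Nat.find_min hex (m := m) (by omega)
      obtain ⟨r, ⟨hrG, hrR⟩, hrT⟩ := SetLike.not_le_iff_exists.1 h2
      have hst : ∀ t ∈ T, t * r + r * t ∈ T := fun t ht =>
        h1 ⟨filG_step T N m t r ht hrG, hR t (hTR ht) r hrR⟩
      have hlt : T < T ⊔ Submodule.span K {r} := by
        refine lt_of_le_of_ne le_sup_left (fun h => hrT ?_)
        rw [h]; exact Submodule.mem_sup_right (Submodule.mem_span_singleton_self r)
      have hle : T ⊔ Submodule.span K {r} ≤ R :=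
        sup_le hTR (by rw [Submodule.span_singleton_le_iff_mem]; exact hrR)
      have f1 := Submodule.finrank_lt_finrank_of_lt hlt
      have f2 := Submodule.finrank_mono hle
      refine ih (Module.finrank K R - Module.finrank K ↥(T ⊔ Submodule.span K {r})) (by omega)
        (T ⊔ Submodule.span K {r}) hle ?_ rfl
      have hrm : r ∈ T ⊔ Submodule.span K {r} :=
        Submodule.mem_sup_right (Submodule.mem_span_singleton_self r)
      intro W2 W hW hs hs2
      obtain ⟨z, hz, hz2, hz3⟩ := hT W2 W hW (fun t ht => hs t (le_sup_left (a := T) ht))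
        (fun t ht => hs2 t (le_sup_left (a := T) ht))
      let Z : Submodule K V :=
        { carrier := {x | x ∈ W ∧ ∀ t ∈ T, t x ∈ W2}
          zero_mem' := ⟨zero_mem _, fun t _ => by simp⟩
          add_mem' := fun ha hb => ⟨add_mem ha.1 hb.1, fun t ht => by
            rw [map_add]; exact add_mem (ha.2 t ht) (hb.2 t ht)⟩
          smul_mem' := fun c a ha => ⟨Submodule.smul_mem _ _ ha.1, fun t ht => by
            rw [map_smul]; exact Submodule.smul_mem _ _ (ha.2 t ht)⟩ }
      obtain ⟨w, hw, hw2, hw3⟩ := nil_step r (hnil r hrR) W2 z Z (by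
        rintro w ⟨hw, hwt⟩
        refine ⟨hs r hrm w hw, fun t ht => ?_⟩
        have e : t (r w) = (t * r + r * t) w - r (t w) := by simp
        rw [e]
        exact sub_mem (hwt _ (hst t ht)) (hs2 r hrm _ (hwt t ht))) ⟨hz, hz3⟩ hz2
      refine ⟨w, hw.1, hw2, fun t ht => ?_⟩
      obtain ⟨t', ht', c, hc, rfl⟩ := Submodule.mem_sup.1 ht
      obtain ⟨α, rfl⟩ := Submodule.mem_span_singleton.1 hc
      exact add_mem (hw.2 t' ht') (Submodule.smul_mem _ _ hw3)
  refine main _ ⊥ bot_le ?_ rfl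
  intro W2 W hW _ _
  obtain ⟨w, hw, hw2⟩ := SetLike.exists_of_lt hW
  refine ⟨w, hw, hw2, ?_⟩
  intro t ht
  rw [(Submodule.mem_bot K).1 ht]; simp

end Abs

section Abs
variable {K V : Type*} [Field K] [AddCommGroup V] [Module K V] [FiniteDimensional K V]

/-- closure -/
structure SClosed (A0 A1 : Submodule K (Module.End K V)) : Prop where
  h00 : ∀ a ∈ A0, ∀ b ∈ A0, a * b + b * a ∈ A0
  h01 : ∀ a ∈ A0, ∀ y ∈ A1, a * y + y * a ∈ A1
  h11 : ∀ y ∈ A1, ∀ z ∈ A1, y * z - z * y ∈ A0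

/-- simplicity -/
structure SSimple (A0 A1 : Submodule K (Module.End K V)) : Prop extends SClosed A0 A1 where
  ideal : ∀ I0 I1 : Submodule K (Module.End K V), I0 ≤ A0 → I1 ≤ A1 →
    (∀ a ∈ A0, ∀ x ∈ I0, a * x + x * a ∈ I0) → (∀ a ∈ A0, ∀ x ∈ I1, a * x + x * a ∈ I1) →
    (∀ y ∈ A1, ∀ x ∈ I0, y * x + x * y ∈ I1) → (∀ y ∈ A1, ∀ x ∈ I1, y * x - x * y ∈ I0) →
    (I0 = ⊥ ∧ I1 = ⊥) ∨ (I0 = A0 ∧ I1 = A1)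
  nz : ¬ ((∀ a ∈ A0, ∀ b ∈ A0, a * b + b * a = 0) ∧ (∀ a ∈ A0, ∀ y ∈ A1, a * y + y * a = 0) ∧
    (∀ y ∈ A1, ∀ z ∈ A1, y * z - z * y = 0))

lemma τ_j (a x c : Module.End K V) : τ ((a * x + x * a) * c) = τ (x * (a * c + c * a)) := by
  have h := τ_comm a (x * c)
  simp only [add_mul, mul_add, map_add, mul_assoc] at *
  linear_combination h

lemma τ_l (y x c : Module.End K V) : τ ((y * x - x * y) * c) = τ (x * (c * y - y * c)) := by
  have h := τ_comm y (x * c)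
  simp only [sub_mul, mul_sub, map_sub, mul_assoc] at *
  linear_combination h

/-- stable pair -/
structure Stab (A0 A1 : Submodule K (Module.End K V)) (P Q : Submodule K V) : Prop where
  p0 : ∀ a ∈ A0, ∀ x ∈ P, a x ∈ P
  q0 : ∀ a ∈ A0, ∀ x ∈ Q, a x ∈ Q
  p1 : ∀ a ∈ A1, ∀ x ∈ P, a x ∈ Q
  q1 : ∀ a ∈ A1, ∀ x ∈ Q, a x ∈ P

/-- trivial action on a section -/
structure Triv (A0 A1 : Submodule K (Module.End K V)) (P1 Q1 P2 Q2 : Submodule K V) : Prop where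
  p0 : ∀ a ∈ A0, ∀ x ∈ P1, a x ∈ P2
  q0 : ∀ a ∈ A0, ∀ x ∈ Q1, a x ∈ Q2
  p1 : ∀ a ∈ A1, ∀ x ∈ P1, a x ∈ Q2
  q1 : ∀ a ∈ A1, ∀ x ∈ Q1, a x ∈ P2

lemma Stab.swap {A0 A1 : Submodule K (Module.End K V)} {P Q : Submodule K V}
    (h : Stab A0 A1 P Q) : Stab A0 A1 Q P := ⟨h.q0, h.p0, h.q1, h.p1⟩

lemma Triv.swap {A0 A1 : Submodule K (Module.End K V)} {P1 Q1 P2 Q2 : Submodule K V}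
    (h : Triv A0 A1 P1 Q1 P2 Q2) : Triv A0 A1 Q1 P1 Q2 P2 := ⟨h.q0, h.p0, h.q1, h.p1⟩

/-- maps sending `P1` to `P2` and `Q1` to `Q2` -/
def carr (P1 Q1 P2 Q2 : Submodule K V) : Submodule K (Module.End K V) where
  carrier := {a | (∀ x ∈ P1, a x ∈ P2) ∧ (∀ x ∈ Q1, a x ∈ Q2)}
  zero_mem' := ⟨fun _ _ => by simp, fun _ _ => by simp⟩
  add_mem' := fun ha hb => ⟨fun x hx => add_mem (ha.1 x hx) (hb.1 x hx),
    fun x hx => add_mem (ha.2 x hx) (hb.2 x hx)⟩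
  smul_mem' := fun _ _ ha => ⟨fun x hx => Submodule.smul_mem _ _ (ha.1 x hx),
    fun x hx => Submodule.smul_mem _ _ (ha.2 x hx)⟩

lemma kill {A0 A1 : Submodule K (Module.End K V)} (hA : SSimple A0 A1)
    {P1 Q1 P2 Q2 : Submodule K V} (h1 : Stab A0 A1 P1 Q1) (h2 : Stab A0 A1 P2 Q2)
    (hn : ¬ Triv A0 A1 P1 Q1 P2 Q2) :
    A0 ⊓ carr P1 Q1 P2 Q2 = ⊥ ∧ A1 ⊓ carr P1 Q1 Q2 P2 = ⊥ := by
  have := hA.ideal (A0 ⊓ carr P1 Q1 P2 Q2) (A1 ⊓ carr P1 Q1 Q2 P2) inf_le_left inf_le_left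
    ?_ ?_ ?_ ?_
  · rcases this with h | ⟨h, h'⟩
    · exact h
    · exact absurd ⟨fun a ha => (inf_eq_left.1 h ha).1, fun a ha => (inf_eq_left.1 h ha).2,
        fun a ha => (inf_eq_left.1 h' ha).1, fun a ha => (inf_eq_left.1 h' ha).2⟩ hn
  · rintro a ha x ⟨hx, hxp, hxq⟩
    exact ⟨hA.h00 a ha x hx, fun v hv => add_mem (h2.p0 a ha _ (hxp v hv)) (hxp _ (h1.p0 a ha v hv)),
      fun v hv => add_mem (h2.q0 a ha _ (hxq v hv)) (hxq _ (h1.q0 a ha v hv))⟩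
  · rintro a ha x ⟨hx, hxp, hxq⟩
    exact ⟨hA.h01 a ha x hx, fun v hv => add_mem (h2.q0 a ha _ (hxp v hv)) (hxp _ (h1.p0 a ha v hv)),
      fun v hv => add_mem (h2.p0 a ha _ (hxq v hv)) (hxq _ (h1.q0 a ha v hv))⟩
  · rintro a ha x ⟨hx, hxp, hxq⟩
    refine ⟨by rw [add_comm]; exact hA.h01 x hx a ha, fun v hv => add_mem (h2.p1 a ha _ (hxp v hv)) (hxq _ (h1.p1 a ha v hv)),
      fun v hv => add_mem (h2.q1 a ha _ (hxq v hv)) (hxp _ (h1.q1 a ha v hv))⟩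
  · rintro a ha x ⟨hx, hxp, hxq⟩
    refine ⟨hA.h11 a ha x hx, fun v hv => sub_mem (h2.q1 a ha _ (hxp v hv)) (hxq _ (h1.p1 a ha v hv)),
      fun v hv => sub_mem (h2.p1 a ha _ (hxq v hv)) (hxp _ (h1.q1 a ha v hv))⟩

/-- the radical -/
def rad (A0 : Submodule K (Module.End K V)) : Submodule K (Module.End K V) where
  carrier := {r | r ∈ A0 ∧ ∀ a ∈ A0, τ (r * a) = 0}
  zero_mem' := ⟨zero_mem _, fun a _ => by simp⟩
  add_mem' := fun ha hb => ⟨add_mem ha.1 hb.1, fun a h => by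
    rw [add_mul, map_add, ha.2 a h, hb.2 a h, add_zero]⟩
  smul_mem' := fun c x ha => ⟨Submodule.smul_mem _ _ ha.1, fun a h => by
    rw [smul_mul_assoc, map_smul, ha.2 a h, smul_zero]⟩

lemma rad_j {A0 : Submodule K (Module.End K V)} (h : ∀ a ∈ A0, ∀ b ∈ A0, a * b + b * a ∈ A0)
    (a r : Module.End K V) (ha : a ∈ A0) (hr : r ∈ rad A0) : a * r + r * a ∈ rad A0 := by
  refine ⟨h a ha r hr.1, fun c hc => ?_⟩
  rw [τ_j]; exact hr.2 _ (h a ha c hc)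

lemma half_mem [CharZero K] {S : Submodule K (Module.End K V)} {x : Module.End K V}
    (h : x + x ∈ S) : x ∈ S := by
  have : x = (2 : K)⁻¹ • (x + x) := by
    rw [← two_smul K x, smul_smul, inv_mul_cancel₀ two_ne_zero, one_smul]
  rw [this]; exact S.smul_mem _ h

lemma half_memV [CharZero K] {S : Submodule K V} {x : V}
    (h : x + x ∈ S) : x ∈ S := by
  have : x = (2 : K)⁻¹ • (x + x) := by
    rw [← two_smul K x, smul_smul, inv_mul_cancel₀ two_ne_zero, one_smul]
  rw [this]; exact S.smul_mem _ h

lemma pow_memJ [CharZero K] {A0 : Submodule K (Module.End K V)}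
    (h : ∀ a ∈ A0, ∀ b ∈ A0, a * b + b * a ∈ A0)
    (r : Module.End K V) (hr : r ∈ A0) (k : ℕ) : r ^ (k + 1) ∈ A0 := by
  induction k with
  | zero => simpa
  | succ k ih =>
    apply half_mem
    have := h r hr _ ih
    rwa [← pow_succ, ← pow_succ'] at this

lemma rad_nil [CharZero K] {A0 : Submodule K (Module.End K V)}
    (h : ∀ a ∈ A0, ∀ b ∈ A0, a * b + b * a ∈ A0) (r) (hr : r ∈ rad A0) : IsNilpotent r := by
  apply nil_of_trace
  intro k
  rw [pow_succ']; exact hr.2 _ (pow_memJ h r hr.1 k)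

lemma rad_D {A0 A1 : Submodule K (Module.End K V)} (hA : SClosed A0 A1)
    (y z r : Module.End K V) (hy : y ∈ A1) (hz : z ∈ A1) (hr : r ∈ rad A0) :
    (y * z + z * y) * r - r * (y * z + z * y) ∈ rad A0 := by
  have key : ∀ r ∈ A0, (y * z + z * y) * r - r * (y * z + z * y) ∈ A0 := by
    intro r hr
    have h1 := hA.h11 y hy _ (hA.h01 r hr z hz)
    have h2 := hA.h11 z hz _ (hA.h01 r hr y hy)
    have := add_mem h1 h2
    convert this using 1
    noncomm_ring
  refine ⟨key r hr.1, fun a ha => ?_⟩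
  rw [τ_l]
  apply hr.2
  have := neg_mem (key a ha)
  convert this using 1
  noncomm_ring

lemma RZ_aux [CharZero K] {A0 A1 : Submodule K (Module.End K V)} (hA : SSimple A0 A1)
    {P1 Q1 P2 Q2 : Submodule K V} (h1 : Stab A0 A1 P1 Q1) (h2 : Stab A0 A1 P2 Q2)
    (hP : P2 ≤ P1) (hQ : Q2 ≤ Q1)
    (hmin : ∀ P Q, Stab A0 A1 P Q → P2 ≤ P → P ≤ P1 → Q2 ≤ Q → Q ≤ Q1 →
      (P = P2 ∧ Q = Q2) ∨ (P = P1 ∧ Q = Q1)) :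
    ∀ r ∈ rad A0, ∀ x ∈ P1, r x ∈ P2 := by
  have hE : NilAct (rad A0) := engel _ (rad_nil hA.h00)
    (fun a ha b hb => rad_j hA.h00 a b ha.1 hb)
  by_cases hPP : P1 ≤ P2
  · intro r hr x hx
    exact h2.p0 r hr.1 _ (hPP hx)
  obtain ⟨w, hw, hw2, hw3⟩ := hE P2 P1 (lt_of_le_not_ge hP hPP) (fun t ht => h1.p0 t ht.1)
    (fun t ht => h2.p0 t ht.1)
  let KP : Submodule K V :=
    { carrier := {x | x ∈ P1 ∧ ∀ t ∈ rad A0, t x ∈ P2}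
      zero_mem' := ⟨zero_mem _, fun t _ => by simp⟩
      add_mem' := fun ha hb => ⟨add_mem ha.1 hb.1, fun t ht => by
        rw [map_add]; exact add_mem (ha.2 t ht) (hb.2 t ht)⟩
      smul_mem' := fun c a ha => ⟨Submodule.smul_mem _ _ ha.1, fun t ht => by
        rw [map_smul]; exact Submodule.smul_mem _ _ (ha.2 t ht)⟩ }
  let Q' : Submodule K V :=
    { carrier := {x | x ∈ Q1 ∧ ∀ t ∈ A1, t x ∈ KP}
      zero_mem' := ⟨zero_mem _, fun t _ => by simp⟩
      add_mem' := fun ha hb => ⟨add_mem ha.1 hb.1, fun t ht => by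
        rw [map_add]; exact add_mem (ha.2 t ht) (hb.2 t ht)⟩
      smul_mem' := fun c a ha => ⟨Submodule.smul_mem _ _ ha.1, fun t ht => by
        rw [map_smul]; exact Submodule.smul_mem _ _ (ha.2 t ht)⟩ }
  have k0 : ∀ a ∈ A0, ∀ x ∈ KP, a x ∈ KP := by
    rintro a ha x ⟨hx, hxr⟩
    refine ⟨h1.p0 a ha x hx, fun r hr => ?_⟩
    have e : r (a x) = (a * r + r * a) x - a (r x) := by simp
    rw [e]
    exact sub_mem (hxr _ (rad_j hA.h00 a r ha hr)) (h2.p0 a ha _ (hxr r hr))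
  have hst : Stab A0 A1 KP Q' := by
    refine ⟨k0, ?_, ?_, fun a ha x hx => hx.2 a ha⟩
    · rintro a ha x ⟨hx, hxr⟩
      refine ⟨h1.q0 a ha x hx, fun y hy => ?_⟩
      have e : y (a x) = (a * y + y * a) x - a (y x) := by simp
      rw [e]
      exact sub_mem (hxr _ (hA.h01 a ha y hy)) (k0 a ha _ (hxr y hy))
    · rintro y hy x hx
      refine ⟨h1.p1 y hy x hx.1, fun z hz => ?_⟩
      apply half_memV
      have e : z (y x) + z (y x) = (z * y - y * z) x + (z * y + y * z) x := by
        simp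
      rw [e]
      refine add_mem (k0 _ (hA.h11 z hz y hy) x hx) ⟨add_mem (h1.q1 z hz _ (h1.p1 y hy x hx.1))
        (h1.q1 y hy _ (h1.p1 z hz x hx.1)), fun r hr => ?_⟩
      have e : r ((z * y + y * z) x) = (z (y (r x)) + y (z (r x))) -
          ((z * y + y * z) * r - r * (z * y + y * z)) x := by simp
      rw [e]
      refine sub_mem (add_mem ?_ ?_) (hx.2 _ (rad_D hA.toSClosed z y r hz hy hr))
      · exact h2.q1 z hz _ (h2.p1 y hy _ (hx.2 r hr))
      · exact h2.q1 y hy _ (h2.p1 z hz _ (hx.2 r hr))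
  have hP2 : P2 ≤ KP := fun x hx => ⟨hP hx, fun r hr => h2.p0 r hr.1 x hx⟩
  rcases hmin KP Q' hst hP2 (fun x hx => hx.1) (fun x hx => ⟨hQ hx, fun t ht => hP2 (h2.q1 t ht x hx)⟩)
    (fun x hx => hx.1) with ⟨h, -⟩ | ⟨h, -⟩
  · exact absurd (h ▸ (⟨hw, hw3⟩ : w ∈ KP)) hw2
  · intro r hr x hx
    rw [← h] at hx
    exact hx.2 r hr

theorem RZ [CharZero K] {A0 A1 : Submodule K (Module.End K V)} (hA : SSimple A0 A1) :
    rad A0 = ⊥ := by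
  have main : ∀ d, ∀ P1 Q1 P2 Q2 : Submodule K V, Stab A0 A1 P1 Q1 → Stab A0 A1 P2 Q2 →
      P2 ≤ P1 → Q2 ≤ Q1 → ¬ Triv A0 A1 P1 Q1 P2 Q2 →
      (Module.finrank K P1 - Module.finrank K P2) + (Module.finrank K Q1 - Module.finrank K Q2) = d →
      rad A0 = ⊥ := by
    intro d
    induction d using Nat.strong_induction_on with
    | _ d ih =>
      intro P1 Q1 P2 Q2 h1 h2 hP hQ hn hd
      obtain ⟨z0, z1⟩ := kill hA h1 h2 hn
      by_cases hmin : ∀ P Q, Stab A0 A1 P Q → P2 ≤ P → P ≤ P1 → Q2 ≤ Q → Q ≤ Q1 →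
        (P = P2 ∧ Q = Q2) ∨ (P = P1 ∧ Q = Q1)
      · have a := RZ_aux hA h1 h2 hP hQ hmin
        have b := RZ_aux hA h1.swap h2.swap hQ hP (fun Q P h a b c d =>
          (hmin P Q h.swap c d a b).imp And.symm And.symm)
        rw [eq_bot_iff, ← z0]
        exact fun r hr => ⟨hr.1, a r hr, b r hr⟩
      · push Not at hmin
        obtain ⟨P, Q, hs, p2, p1, q2, q1, n2, n1⟩ := hmin
        have f1 := Submodule.finrank_mono p2
        have f2 := Submodule.finrank_mono p1
        have f3 := Submodule.finrank_mono q2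
        have f4 := Submodule.finrank_mono q1
        by_cases t1 : Triv A0 A1 P1 Q1 P Q
        · by_cases t2 : Triv A0 A1 P Q P2 Q2
          · exfalso
            apply hA.nz
            refine ⟨fun a ha b hb => ?_, fun a ha b hb => ?_, fun a ha b hb => ?_⟩
            · have : a * b + b * a ∈ A0 ⊓ carr P1 Q1 P2 Q2 := ⟨hA.h00 a ha b hb,
                fun x hx => add_mem (t2.p0 a ha _ (t1.p0 b hb x hx)) (t2.p0 b hb _ (t1.p0 a ha x hx)),
                fun x hx => add_mem (t2.q0 a ha _ (t1.q0 b hb x hx)) (t2.q0 b hb _ (t1.q0 a ha x hx))⟩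
              rwa [z0] at this
            · have : a * b + b * a ∈ A1 ⊓ carr P1 Q1 Q2 P2 := ⟨hA.h01 a ha b hb,
                fun x hx => add_mem (t2.q0 a ha _ (t1.p1 b hb x hx)) (t2.p1 b hb _ (t1.p0 a ha x hx)),
                fun x hx => add_mem (t2.p0 a ha _ (t1.q1 b hb x hx)) (t2.q1 b hb _ (t1.q0 a ha x hx))⟩
              rwa [z1] at this
            · have : a * b - b * a ∈ A0 ⊓ carr P1 Q1 P2 Q2 := ⟨hA.h11 a ha b hb,
                fun x hx => sub_mem (t2.q1 a ha _ (t1.p1 b hb x hx)) (t2.q1 b hb _ (t1.p1 a ha x hx)),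
                fun x hx => sub_mem (t2.p1 a ha _ (t1.q1 b hb x hx)) (t2.p1 b hb _ (t1.q1 a ha x hx))⟩
              rwa [z0] at this
          · refine ih _ ?_ P Q P2 Q2 hs h2 p2 q2 t2 rfl
            by_contra hc
            have e1 := Submodule.eq_of_le_of_finrank_eq p1 (by omega)
            exact n1 e1 (Submodule.eq_of_le_of_finrank_eq q1 (by omega))
        · refine ih _ ?_ P1 Q1 P Q h1 hs p1 q1 t1 rfl
          by_contra hc
          have e1 := Submodule.eq_of_le_of_finrank_eq p2 (by omega)
          exact n2 e1.symm (Submodule.eq_of_le_of_finrank_eq q2 (by omega)).symm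
  refine main _ ⊤ ⊤ ⊥ ⊥ ?_ ?_ bot_le bot_le ?_ rfl
  · exact ⟨fun _ _ _ _ => trivial, fun _ _ _ _ => trivial, fun _ _ _ _ => trivial,
      fun _ _ _ _ => trivial⟩
  · have : ∀ a : Module.End K V, ∀ x ∈ (⊥ : Submodule K V), a x ∈ (⊥ : Submodule K V) := by
      intro a x hx
      rw [(Submodule.mem_bot K).1 hx, map_zero]; exact zero_mem _
    exact ⟨fun a _ => this a, fun a _ => this a, fun a _ => this a, fun a _ => this a⟩
  · intro ht
    apply hA.nz
    have z0 : ∀ a ∈ A0, a = 0 := fun a ha => LinearMap.ext fun x => ht.p0 a ha x trivial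
    have z1 : ∀ a ∈ A1, a = 0 := fun a ha => LinearMap.ext fun x => ht.p1 a ha x trivial
    refine ⟨fun a ha b hb => ?_, fun a ha b hb => ?_, fun a ha b hb => ?_⟩
    · rw [z0 a ha]; simp
    · rw [z0 a ha]; simp
    · rw [z1 a ha]; simp

end Abs

section Abs
variable {K V : Type*} [Field K] [AddCommGroup V] [Module K V] [FiniteDimensional K V]

/-- the pairing -/
noncomputable def pairing (S T : Submodule K (Module.End K V)) : S →ₗ[K] T →ₗ[K] K :=
  LinearMap.mk₂ K (fun s t => τ ((s : Module.End K V) * (t : Module.End K V)))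
    (by intros; simp [add_mul]) (by intros; simp) (by intros; simp [mul_add]) (by intros; simp)

lemma represent (S T : Submodule K (Module.End K V))
    (h : ∀ t ∈ T, (∀ s ∈ S, τ (s * t) = 0) → t = 0) (φ : Module.End K V →ₗ[K] K) :
    ∃ s ∈ S, ∀ t ∈ T, τ (s * t) = φ t := by
  have hs : Function.Surjective (pairing S T) := by
    rw [← LinearMap.flip_injective_iff₁, ← LinearMap.ker_eq_bot, LinearMap.ker_eq_bot']
    intro t ht
    apply Subtype.ext
    apply h t.1 t.2
    intro s hs
    exact LinearMap.congr_fun ht ⟨s, hs⟩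
  obtain ⟨s, hs⟩ := hs (φ.comp T.subtype)
  exact ⟨s.1, s.2, fun t ht => LinearMap.congr_fun hs ⟨t, ht⟩⟩

lemma rad_zero {A0 : Submodule K (Module.End K V)} (h : rad A0 = ⊥) {t : Module.End K V}
    (ht : t ∈ A0) (h2 : ∀ a ∈ A0, τ (t * a) = 0) : t = 0 := by
  have : t ∈ rad A0 := ⟨ht, h2⟩
  rwa [h] at this

lemma unit_of_idem [CharZero K] (g a : Module.End K V) (hg : g * g + g * g = g + g)
    (ha : a * g + g * a = a + a) : g * a = a ∧ a * g = a := by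
  have two : ∀ x y : Module.End K V, x + x = y + y → x = y := by
    intro x y h
    rw [← two_smul K x, ← two_smul K y] at h
    exact smul_right_injective _ (two_ne_zero) h
  have gg : g * g = g := two _ _ hg
  have e1 : g * (a * g) = g * a := by
    have := congrArg (fun x => g * x) ha
    simp only [mul_add, ← mul_assoc, gg] at this
    rw [add_left_inj] at this
    rw [← mul_assoc]; exact this
  have e2 : g * (a * g) = a * g := by
    have := congrArg (fun x => x * g) ha
    simp only [add_mul, mul_assoc, gg] at this
    rw [add_right_inj] at this
    exact this
  have e3 : g * a = a * g := e1.symm.trans e2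
  have e4 : a * g = a := two _ _ (by rw [e3] at ha; exact ha)
  exact ⟨e3.trans e4, e4⟩

lemma exists_unit [CharZero K] {J : Submodule K (Module.End K V)}
    (hJ : ∀ a ∈ J, ∀ b ∈ J, a * b + b * a ∈ J) (hr : rad J = ⊥) :
    ∃ g ∈ J, ∀ a ∈ J, g * a = a ∧ a * g = a := by
  obtain ⟨g, hg, hg2⟩ := represent J J (fun t ht h => rad_zero hr ht (fun a ha => by
    rw [τ_comm]; exact h a ha)) (τ)
  have key : ∀ a ∈ J, a * g + g * a = a + a := by
    intro a ha
    rw [← sub_eq_zero]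
    apply rad_zero hr (sub_mem (hJ a ha g hg) (add_mem ha ha))
    intro c hc
    rw [sub_mul, map_sub, τ_j, hg2 _ (hJ a ha c hc), map_add, add_mul, map_add, τ_comm c a, sub_self]
  exact ⟨g, hg, fun a ha => unit_of_idem g a (key g hg) (key a ha)⟩

lemma triple [CharZero K] {J : Submodule K (Module.End K V)}
    (hJ : ∀ a ∈ J, ∀ b ∈ J, a * b + b * a ∈ J) (a b c : Module.End K V) (ha : a ∈ J) (hb : b ∈ J)
    (hc : c ∈ J) : a * b * c + c * b * a ∈ J := by
  apply half_mem
  have := sub_mem (add_mem (hJ _ (hJ a ha b hb) c hc) (hJ a ha _ (hJ b hb c hc)))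
    (hJ b hb _ (hJ a ha c hc))
  convert this using 1
  noncomm_ring

lemma sand [CharZero K] {J : Submodule K (Module.End K V)}
    (hJ : ∀ a ∈ J, ∀ b ∈ J, a * b + b * a ∈ J) (a b : Module.End K V) (ha : a ∈ J) (hb : b ∈ J) :
    a * b * a ∈ J := half_mem (triple hJ a b a ha hb ha)

lemma eq_of_dual (x y : V) (h : ∀ μ : Module.Dual K V, μ x = μ y) : x = y := by
  rw [← sub_eq_zero, ← Module.forall_dual_apply_eq_zero_iff K]
  intro μ; rw [map_sub, h, sub_self]

/-- good position -/
def Good (J : Submodule K (Module.End K V)) (v : V) (l : Module.Dual K V) : Prop :=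
  ∀ (w : V) (μ : Module.Dual K V), l w = μ v → ∃ b ∈ J, b v = w ∧ ∀ x, l (b x) = μ x

lemma lemIII [CharZero K] {J : Submodule K (Module.End K V)}
    (hJ : ∀ a ∈ J, ∀ b ∈ J, a * b + b * a ∈ J) (hr : rad J = ⊥) (v : V) (l : Module.Dual K V)
    (hlv : l v = 1) (hG : Good J v l) :
    (∃ μ : Module.Dual K V, μ ≠ 0 ∧ μ.smulRight v ∈ J) ∨
    (∃ w : V, w ≠ 0 ∧ l.smulRight w ∈ J) := by
  by_contra hcon
  push Not at hcon
  obtain ⟨hc1, hc2⟩ := hcon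
  have hv' : ∀ w, ∃ b ∈ J, b v = w := fun w => by
    obtain ⟨b, hb, h, -⟩ := hG w (l w • l) (by simp [hlv])
    exact ⟨b, hb, h⟩
  have hl' : ∀ μ : Module.Dual K V, ∃ b ∈ J, ∀ x, l (b x) = μ x := fun μ => by
    obtain ⟨b, hb, -, h⟩ := hG (μ v • v) μ (by simp [hlv])
    exact ⟨b, hb, h⟩
  have h1 : (1 : Module.End K V) ∈ J := by
    obtain ⟨g, hg, hg2⟩ := exists_unit hJ hr
    have : g = 1 := by
      ext w
      obtain ⟨b, hb, rfl⟩ := hv' w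
      exact LinearMap.congr_fun (hg2 b hb).1 v
    rwa [← this]
  obtain ⟨s, hs, hs2⟩ := represent J J (fun t ht h => rad_zero hr ht (fun a ha => by
    rw [τ_comm]; exact h a ha)) ((l : V →ₗ[K] K).comp (LinearMap.applyₗ v))
  replace hs2 : ∀ b ∈ J, τ (s * b) = l (b v) := hs2
  have key : ∀ a ∈ J, ∀ b ∈ J, ∀ c ∈ J,
      l (c (s ((a * s * b - b * s * a) v))) = l ((a * s * b - b * s * a) (s (c v))) := by
    intro a ha b hb c hc
    have m1 := triple hJ c (s * a * s) b hc (sand hJ s a hs ha) hb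
    have m2 := triple hJ c (s * b * s) a hc (sand hJ s b hs hb) ha
    have m := sub_mem m1 m2
    have e : c * (s * a * s) * b + b * (s * a * s) * c - (c * (s * b * s) * a + a * (s * b * s) * c)
      = c * s * (a * s * b - b * s * a) - (a * s * b - b * s * a) * s * c := by noncomm_ring
    rw [e] at m
    have h2 := hs2 _ m
    have h3 : τ (s * (c * s * (a * s * b - b * s * a) - (a * s * b - b * s * a) * s * c)) = 0 := by
      rw [mul_sub, map_sub, sub_eq_zero]
      have := τ_comm (s * c) (s * (a * s * b - b * s * a))
      simp only [mul_assoc] at this ⊢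
      rw [this]
    rw [h3] at h2
    simp only [LinearMap.sub_apply, map_sub, Module.End.mul_apply] at h2 ⊢
    linear_combination -h2
  have key1 : ∀ a ∈ J, ∀ b ∈ J, ∃ k : K, s ((a * s * b - b * s * a) v) = k • v := by
    intro a ha b hb
    refine ⟨l (s ((a * s * b - b * s * a) v)), eq_of_dual (K := K) _ _ fun ν => ?_⟩
    obtain ⟨c, hc, hcv, hcl⟩ := hG 0 (ν - ν v • l) (by simp [hlv])
    have := key a ha b hb c hc
    rw [hcl, hcv] at this
    simp only [map_zero, LinearMap.sub_apply (f := ν), LinearMap.smul_apply, smul_eq_mul] at this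
    rw [map_smul, smul_eq_mul]
    linear_combination this
  have key2 : ∀ a ∈ J, ∀ b ∈ J, ∃ k : K, ∀ x, l ((a * s * b - b * s * a) (s x)) = k * l x := by
    intro a ha b hb
    refine ⟨l ((a * s * b - b * s * a) (s v)), fun x => ?_⟩
    obtain ⟨c, hc, hcv, hcl⟩ := hG (x - l x • v) 0 (by simp [hlv])
    have := key a ha b hb c hc
    rw [hcl, hcv, map_sub s, map_smul s, map_sub (a * s * b - b * s * a), map_smul (a * s * b - b * s * a),
      map_sub l, map_smul l, LinearMap.zero_apply, smul_eq_mul] at this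
    linear_combination -this
  have z1 : ∀ b ∈ J, b v = 0 → s * b * s = 0 := by
    intro b hb hbv
    have e : s * b * s = (l.comp (s * b * s)).smulRight v := by
      ext x
      obtain ⟨a, ha, rfl⟩ := hv' x
      obtain ⟨k, hk⟩ := key1 a ha b hb
      have : (s * b * s) (a v) = (-k) • v := by
        simp only [LinearMap.sub_apply, Module.End.mul_apply, hbv, map_zero, zero_sub, map_neg] at hk ⊢
        rw [neg_smul, ← hk, neg_neg]
      simp [this, hlv]
    by_contra hne
    have := hc1 (l.comp (s * b * s)) (fun h0 => hne (by rw [e, h0]; ext; simp))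
    exact this (e ▸ sand hJ s b hs hb)
  have z2 : ∀ b ∈ J, (∀ x, l (b x) = 0) → s * b * s = 0 := by
    intro b hb hbl
    have e : s * b * s = l.smulRight ((s * b * s) v) := by
      ext x
      apply eq_of_dual (K := K)
      intro μ
      obtain ⟨a, ha, hal⟩ := hl' μ
      obtain ⟨k, hk⟩ := key2 a ha b hb
      have hk' : ∀ x, μ ((s * b * s) x) = k * l x := by
        intro x
        have := hk x
        simp only [LinearMap.sub_apply, Module.End.mul_apply, map_sub, hbl, hal, sub_zero] at this ⊢
        exact this
      rw [hk', LinearMap.smulRight_apply, map_smul, hk', hlv, smul_eq_mul]; ring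
    by_contra hne
    have := hc2 ((s * b * s) v) (fun h0 => hne (by rw [e, h0]; ext; simp))
    exact this (e ▸ sand hJ s b hs hb)
  have z3 : ∀ b ∈ J, s * b * s = l (b v) • (s * s) := by
    intro b hb
    have hc : b - l (b v) • 1 ∈ J := sub_mem hb (J.smul_mem _ h1)
    obtain ⟨b1, hb1, e1, e2⟩ := hG ((b - l (b v) • 1) v) 0 (by simp [hlv])
    have y1 := z2 b1 hb1 e2
    have y2 := z1 (b - l (b v) • 1 - b1) (sub_mem hc hb1) (by rw [LinearMap.sub_apply, e1, sub_self])
    rw [mul_sub, sub_mul, y1, sub_zero, mul_sub, sub_mul, sub_eq_zero] at y2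
    rw [y2]; simp
  have hanti : ∀ b ∈ J, l (s (b v)) + l (b (s v)) = τ (s * b * s) + τ (s * b * s) := by
    intro b hb
    have := hs2 _ (hJ s hs b hb)
    rw [LinearMap.add_apply, map_add] at this
    simp only [Module.End.mul_apply] at this
    rw [← this, mul_add, map_add, τ_comm s (s * b), ← mul_assoc]
  have hsv : s v = l (s v) • v := by
    apply eq_of_dual (K := K)
    intro ν
    obtain ⟨b, hb, e1, e2⟩ := hG 0 (ν - ν v • l) (by simp [hlv])
    have := hanti b hb
    rw [z1 b hb e1, e1, e2] at this
    simp at this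
    rw [map_smul, smul_eq_mul]; linear_combination this
  have hls : ∀ x, l (s x) = l (s v) * l x := by
    intro x
    obtain ⟨b, hb, e1, e2⟩ := hG (x - l x • v) 0 (by simp [hlv])
    have := hanti b hb
    rw [z2 b hb e2, e1, e2] at this
    simp at this
    linear_combination this
  by_cases hσ : l (s v) = 0
  · have hss : s * s = 0 := by
      apply rad_zero hr
      · have := pow_memJ hJ s hs 1
        rwa [← pow_two]
      · intro b hb
        have := hanti b hb
        rw [hls, hsv, hσ] at this
        simp at this
        rw [mul_assoc, τ_comm]
        exact add_self_eq_zero.1 this.symm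
    have h2 : IsNilpotent (τ s) := LinearMap.isNilpotent_trace_of_isNilpotent ⟨2, by rw [pow_two, hss]⟩
    have h3 := hs2 1 h1
    rw [mul_one, h2.eq_zero] at h3
    simp [hlv] at h3
  · have e : s = (l.comp s).smulRight v := by
      obtain ⟨σ, hσe⟩ : ∃ σ, σ = l (s v) := ⟨_, rfl⟩
      rw [← hσe] at hsv hσ
      ext x
      obtain ⟨b, hb, rfl⟩ := hv' x
      have := LinearMap.congr_fun (z3 b hb) v
      simp only [Module.End.mul_apply, LinearMap.smul_apply] at this
      rw [hsv, map_smul, map_smul, map_smul, hsv, smul_comm] at this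
      have h3 := smul_right_injective V hσ this
      rw [h3]
      simp [hlv, h3, smul_smul]
    refine hc1 (l.comp s) (fun h0 => hσ ?_) (e ▸ hs)
    exact LinearMap.congr_fun h0 v

end Abs

section Abs
variable {K V : Type*} [Field K] [AddCommGroup V] [Module K V] [FiniteDimensional K V]

theorem burnside [IsAlgClosed K] [Nontrivial V] (C : Subalgebra K (Module.End K V))
    (hirr : ∀ W : Submodule K V, (∀ a ∈ C, ∀ w ∈ W, a w ∈ W) → W = ⊥ ∨ W = ⊤)
    (f : Module.End K V) : f ∈ C := by
  classical
  have hsc : IsScalarTower K C V := ⟨fun c a x => rfl⟩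
  have hsimple : IsSimpleModule C V := by
    have : IsSimpleOrder (Submodule C V) := by
     refine ⟨fun U => ?_⟩
     let W : Submodule K V :=
       { U.toAddSubmonoid with
         smul_mem' := fun c x hx => by
           have h := U.smul_mem (algebraMap K C c) hx
           exact h }
     rcases hirr W (fun a ha w hw => U.smul_mem (⟨a, ha⟩ : C) hw) with h | h
     · left
       rw [Submodule.eq_bot_iff] at h ⊢
       exact h
     · right
       rw [Submodule.eq_top_iff'] at h ⊢
       exact h
    exact ⟨⟩
  let F : Module.End (Module.End C V) V :=
    { toFun := f
      map_add' := f.map_add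
      map_smul' := fun g x => by
        obtain ⟨c, rfl⟩ := (IsSimpleModule.algebraMap_end_bijective_of_isAlgClosed (A := C) (V := V) K).2 g
        exact f.map_smul c x }
  let b := Module.finBasis K V
  obtain ⟨r, hr⟩ := jacobson_density F (Finset.univ.image b)
  have : f = r.1 := b.ext fun i => hr (b i) (by simp)
  rw [this]; exact r.2

/-- nondegeneracy of the odd form -/
def ND (A0 A1 : Submodule K (Module.End K V)) : Prop :=
  (∀ a ∈ A0, (∀ y ∈ A1, τ (a * y) = 0) → a = 0) ∧ (∀ y ∈ A1, (∀ a ∈ A0, τ (a * y) = 0) → y = 0)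

/-- orthogonal complement -/
noncomputable def perpMap (S : Submodule K (Module.End K V)) : Module.End K V →ₗ[K] Module.Dual K S :=
  LinearMap.mk₂ K (fun s t => τ (s * (t : Module.End K V)))
    (by intros; simp [add_mul]) (by intros; simp) (by intros; simp [mul_add]) (by intros; simp)

/-- orthogonal complement -/
noncomputable def perp (S : Submodule K (Module.End K V)) : Submodule K (Module.End K V) :=
  LinearMap.ker (perpMap S)

lemma mem_perp {S : Submodule K (Module.End K V)} {x : Module.End K V} :
    x ∈ perp S ↔ ∀ s ∈ S, τ (x * s) = 0 := by
  unfold perp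
  rw [LinearMap.mem_ker]
  constructor
  · intro h s hs
    exact LinearMap.congr_fun h ⟨s, hs⟩
  · intro h
    ext s
    exact h s.1 s.2

lemma finrank_perp (S : Submodule K (Module.End K V)) :
    Module.finrank K S + Module.finrank K (perp S) = Module.finrank K (Module.End K V) := by
  have hs : Function.Surjective (perpMap S) := by
    rw [← LinearMap.flip_injective_iff₁, ← LinearMap.ker_eq_bot, LinearMap.ker_eq_bot']
    intro t ht
    apply Subtype.ext
    apply τ_nondeg
    intro b
    rw [τ_comm]
    exact LinearMap.congr_fun ht b
  have := LinearMap.finrank_range_add_finrank_ker (perpMap S)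
  rw [LinearMap.range_eq_top.2 hs, finrank_top, Subspace.dual_finrank_eq] at this
  exact this

lemma form_dich {A0 A1 : Submodule K (Module.End K V)} (hA : SSimple A0 A1) :
    ND A0 A1 ∨ (∀ a ∈ A0, ∀ y ∈ A1, τ (a * y) = 0) := by
  have := hA.ideal (A0 ⊓ perp A1) (A1 ⊓ perp A0) inf_le_left inf_le_left ?_ ?_ ?_ ?_
  · rcases this with ⟨h0, h1⟩ | ⟨h0, h1⟩
    · left
      constructor
      · intro a ha h
        have : a ∈ A0 ⊓ perp A1 := ⟨ha, mem_perp.2 h⟩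
        rwa [h0] at this
      · intro a ha h
        have : a ∈ A1 ⊓ perp A0 := ⟨ha, mem_perp.2 fun s hs => by rw [τ_comm]; exact h s hs⟩
        rwa [h1] at this
    · right
      intro a ha y hy
      exact mem_perp.1 (inf_eq_left.1 h0 ha) y hy
  · rintro a ha x ⟨hx, hxp⟩
    refine ⟨hA.h00 a ha x hx, mem_perp.2 fun s hs => ?_⟩
    rw [τ_j]; exact mem_perp.1 hxp _ (hA.h01 a ha s hs)
  · rintro a ha x ⟨hx, hxp⟩
    refine ⟨hA.h01 a ha x hx, mem_perp.2 fun s hs => ?_⟩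
    rw [τ_j]; exact mem_perp.1 hxp _ (hA.h00 a ha s hs)
  · rintro a ha x ⟨hx, hxp⟩
    refine ⟨by rw [add_comm]; exact hA.h01 x hx a ha, mem_perp.2 fun s hs => ?_⟩
    rw [τ_j]; exact mem_perp.1 hxp _ (by rw [add_comm]; exact hA.h01 s hs a ha)
  · rintro a ha x ⟨hx, hxp⟩
    refine ⟨hA.h11 a ha x hx, mem_perp.2 fun s hs => ?_⟩
    rw [τ_l]; exact mem_perp.1 hxp _ (hA.h11 s hs a ha)

lemma ND.finrank_eq {A0 A1 : Submodule K (Module.End K V)} (h : ND A0 A1) :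
    Module.finrank K A0 = Module.finrank K A1 := by
  have key : ∀ S T : Submodule K (Module.End K V), (∀ s ∈ S, (∀ t ∈ T, τ (s * t) = 0) → s = 0) →
      Module.finrank K S ≤ Module.finrank K T := by
    intro S T h
    rw [← Subspace.dual_finrank_eq (V := T)]
    apply LinearMap.finrank_le_finrank_of_injective (f := pairing S T)
    rw [← LinearMap.ker_eq_bot, LinearMap.ker_eq_bot']
    intro s hs
    exact Subtype.ext (h s.1 s.2 fun t ht => LinearMap.congr_fun hs ⟨t, ht⟩)
  exact le_antisymm (key _ _ h.1) (key _ _ fun y hy hh => h.2 y hy fun a ha => by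
    rw [τ_comm]; exact hh a ha)

lemma ND.unit [CharZero K] {A0 A1 : Submodule K (Module.End K V)} (h : ND A0 A1)
    (hA : SClosed A0 A1) : ∃ p ∈ A0, (∀ a ∈ A0, p * a = a ∧ a * p = a) ∧
      (∀ a ∈ A1, p * a = a ∧ a * p = a) := by
  obtain ⟨p, hp, hp2⟩ := represent A0 A1 h.2 τ
  have k0 : ∀ a ∈ A0, a * p + p * a = a + a := by
    intro a ha
    rw [← sub_eq_zero]
    apply h.1 _ (sub_mem (hA.h00 a ha p hp) (add_mem ha ha))
    intro y hy
    rw [sub_mul, map_sub, τ_j, hp2 _ (hA.h01 a ha y hy), map_add, add_mul, map_add, τ_comm y a,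
      sub_self]
  have k1 : ∀ y ∈ A1, y * p + p * y = y + y := by
    intro y hy
    rw [← sub_eq_zero]
    apply h.2 _ (sub_mem (by rw [add_comm]; exact hA.h01 p hp y hy) (add_mem hy hy))
    intro a ha
    rw [τ_comm, sub_mul, map_sub, τ_j, hp2 _ (by rw [add_comm]; exact hA.h01 a ha y hy), map_add,
      add_mul, map_add, τ_comm y a, sub_self]
  exact ⟨p, hp, fun a ha => unit_of_idem p a (k0 p hp) (k0 a ha),
    fun a ha => unit_of_idem p a (k0 p hp) (k1 a ha)⟩

lemma idem_vec (p : Module.End K V) (hp : p * p = p) (h1 : p ≠ 1) :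
    ∃ (v : V) (l : Module.Dual K V), l v = 1 ∧ p v = 0 ∧ ∀ x, l (p x) = 0 := by
  have : ∃ x, x - p x ≠ 0 := by
    by_contra hc
    push Not at hc
    exact h1 (LinearMap.ext fun x => (sub_eq_zero.1 (hc x)).symm)
  obtain ⟨x, hx⟩ := this
  have hpp : ∀ x, p (p x) = p x := fun x => LinearMap.congr_fun hp x
  obtain ⟨l, hl⟩ : ∃ l : Module.Dual K V, l (x - p x) ≠ 0 := by
    by_contra hc
    push Not at hc
    exact hx ((Module.forall_dual_apply_eq_zero_iff K _).1 hc)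
  refine ⟨x - p x, (l (x - p x))⁻¹ • (l - l.comp p), ?_, ?_, ?_⟩
  · have e : (l - l.comp p) (x - p x) = l (x - p x) := by
      simp [hpp]
    rw [LinearMap.smul_apply, e, smul_eq_mul, inv_mul_cancel₀ hl]
  · simp [hpp]
  · intro x; simp [hpp]

lemma lemN1 [IsAlgClosed K] [CharZero K] [Nontrivial V] {A0 A1 : Submodule K (Module.End K V)}
    (h : ND A0 A1) (hA : SClosed A0 A1) (h1 : (1 : Module.End K V) ∈ A0)
    (hirr : ∀ W : Submodule K V, (∀ a ∈ A0, ∀ w ∈ W, a w ∈ W) → (∀ a ∈ A1, ∀ w ∈ W, a w ∈ W) →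
      W = ⊥ ∨ W = ⊤) : A0 = ⊤ ∧ A1 = ⊤ := by
  obtain ⟨p, hp, hp2⟩ := represent A1 A0 (fun a ha hh => h.1 a ha fun y hy => by
    rw [τ_comm]; exact hh y hy) τ
  have c1 : ∀ y ∈ A1, y * p = p * y := by
    intro y hy
    rw [← sub_eq_zero]
    apply h.1 _ (hA.h11 y hy p hp)
    intro z hz
    rw [τ_l, hp2 _ (hA.h11 z hz y hy), map_sub, τ_comm, sub_self]
  have c2 : ∀ a ∈ A0, ∀ b ∈ A0, (a * p - p * a) * b = b * (a * p - p * a) := by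
    intro a ha b hb
    have e : (a * p - p * a) * b - b * (a * p - p * a) =
        (a * (b * p + p * b) + (b * p + p * b) * a) - ((a * b + b * a) * p + p * (a * b + b * a)) := by
      noncomm_ring
    rw [← sub_eq_zero]
    apply h.2
    · rw [e]
      exact sub_mem (hA.h01 a ha _ (hA.h01 b hb p hp)) (hA.h01 _ (hA.h00 a ha b hb) p hp)
    · intro c hc
      rw [e, τ_comm, sub_mul, map_sub, τ_j, τ_j, τ_j, hp2 _ (hA.h00 b hb _ (hA.h00 a ha c hc)),
        hp2 _ (hA.h00 _ (hA.h00 a ha b hb) c hc), map_add, map_add, τ_comm _ b, τ_comm c, τ_j, sub_self]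
  have c3 : ∀ a ∈ A0, ∀ y ∈ A1, (a * p - p * a) * y + y * (a * p - p * a) = 0 := by
    intro a ha y hy
    have := c1 _ (hA.h01 a ha y hy)
    have hy := c1 y hy
    have e : (a * p - p * a) * y + y * (a * p - p * a) =
      ((a * y + y * a) * p - p * (a * y + y * a)) - a * (y * p - p * y) - (y * p - p * y) * a := by
      noncomm_ring
    rw [e, this, hy]; simp
  have c4 : ∀ a ∈ A0, a * p - p * a = 0 := by
    intro a ha
    set k := a * p - p * a with hk
    have hak : Commute a k := (c2 a ha a ha).symm
    have hnil : IsNilpotent k := by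
      apply nil_of_trace
      intro m
      have e1 : k ^ (m + 2) = a * (p * k ^ (m+1)) - p * k ^ (m+1) * a := by
        have := (hak.pow_right (m+1)).eq
        calc k ^ (m + 2) = k * k ^ (m+1) := by rw [← pow_succ']
          _ = (a * p - p * a) * k ^ (m+1) := by rw [← hk]
          _ = a * (p * k ^ (m+1)) - p * (a * k ^ (m+1)) := by noncomm_ring
          _ = _ := by rw [this]; noncomm_ring
      rw [e1, map_sub, τ_comm, sub_self]
    obtain ⟨z, hz⟩ := exists_ne (0 : V)
    obtain ⟨w, -, hw, hw2⟩ := nil_step k hnil ⊥ z ⊤ (fun _ _ => trivial) trivial hz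
    have hh := hirr (LinearMap.ker k) ?_ ?_
    · rcases hh with hker | hker
      swap
      · exact LinearMap.ker_eq_top.1 hker
      have : w ∈ LinearMap.ker k := hw2
      rw [hker] at this; exact absurd this hw
    · intro b hb w hw
      have := LinearMap.congr_fun (c2 a ha b hb) w
      rw [← hk] at this
      simp only [Module.End.mul_apply, LinearMap.mem_ker.1 hw, map_zero] at this
      exact this
    · intro b hb w hw
      have := LinearMap.congr_fun (c3 a ha b hb) w
      rw [← hk] at this
      simp only [LinearMap.add_apply, Module.End.mul_apply, LinearMap.mem_ker.1 hw, map_zero, add_zero] at this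
      exact this
  have hp1 : p = 1 := by
    obtain ⟨c, hc⟩ := Module.End.exists_eigenvalue p
    have hst : ∀ b : Module.End K V, b * p = p * b → ∀ w ∈ Module.End.eigenspace p c,
        b w ∈ Module.End.eigenspace p c := by
      intro b hb w hw
      rw [Module.End.mem_eigenspace_iff] at hw ⊢
      have := LinearMap.congr_fun hb w
      simp only [Module.End.mul_apply, hw, map_smul] at this
      exact this.symm
    have htop := (hirr _ (fun b hb => hst b (sub_eq_zero.1 (c4 b hb))) (fun b hb => hst b (c1 b hb))).resolve_left hc
    have hpc : p = c • 1 := by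
      ext w
      have : w ∈ Module.End.eigenspace p c := by rw [htop]; trivial
      rw [Module.End.mem_eigenspace_iff] at this
      simpa using this
    have ht := hp2 1 h1
    rw [mul_one, hpc, map_smul, smul_eq_mul] at ht
    have hn0 : τ (1 : Module.End K V) ≠ 0 := by
      rw [LinearMap.trace_one]
      exact_mod_cast (Module.finrank_pos (R := K) (M := V)).ne'
    have : c = 1 := by
      apply mul_right_cancel₀ hn0
      rw [ht, one_mul]
    rw [hpc, this, one_smul]
  rw [hp1] at hp
  have hle : A0 ≤ A1 := by
    intro a ha
    apply half_mem
    simpa using hA.h01 a ha 1 hp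
  have heq : A0 = A1 := Submodule.eq_of_le_of_finrank_eq hle h.finrank_eq
  have hmul : ∀ a ∈ A0, ∀ b ∈ A0, a * b ∈ A0 := by
    intro a ha b hb
    apply half_mem
    have := add_mem (hA.h00 a ha b hb) (hA.h11 a (hle ha) b (hle hb))
    convert this using 1
    noncomm_ring
  let C : Subalgebra K (Module.End K V) := A0.toSubalgebra h1 (fun a b ha hb => hmul a ha b hb)
  have hC : ∀ f, f ∈ A0 := by
    intro f
    have := burnside C (fun W hW => hirr W (fun a ha => hW a ha) (fun a ha => hW a (heq.ge ha))) f
    exact this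
  have h0 : A0 = ⊤ := Submodule.eq_top_iff'.2 hC
  exact ⟨h0, heq ▸ h0⟩

lemma sq_bound {f d e : ℕ} (h1 : f ≤ d * d) (h2 : f ≤ e * e) : 4 * f ≤ (d + e) * (d + e) := by
  rcases le_total d e with h | h <;> nlinarith

lemma faith {A0 A1 : Submodule K (Module.End K V)} (hA : SSimple A0 A1)
    (h1 : (1 : Module.End K V) ∈ A0) (W : Submodule K V) (s0 : ∀ a ∈ A0, ∀ w ∈ W, a w ∈ W)
    (s1 : ∀ a ∈ A1, ∀ w ∈ W, a w ∈ W) (hb : W ≠ ⊥) (ht : W ≠ ⊤) :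
    (∀ a ∈ A0, (∀ w ∈ W, a w = 0) → a = 0) ∧ (∀ a ∈ A0, (∀ x, a x ∈ W) → a = 0) := by
  have sW : Stab A0 A1 W W := ⟨s0, s0, s1, s1⟩
  have sT : Stab A0 A1 (⊤ : Submodule K V) ⊤ :=
    ⟨fun _ _ _ _ => trivial, fun _ _ _ _ => trivial, fun _ _ _ _ => trivial,
      fun _ _ _ _ => trivial⟩
  have sB : Stab A0 A1 (⊥ : Submodule K V) ⊥ := by
    have : ∀ a : Module.End K V, ∀ x ∈ (⊥ : Submodule K V), a x ∈ (⊥ : Submodule K V) := by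
      intro a x hx
      rw [(Submodule.mem_bot K).1 hx, map_zero]; exact zero_mem _
    exact ⟨fun a _ => this a, fun a _ => this a, fun a _ => this a, fun a _ => this a⟩
  obtain ⟨k1, -⟩ := kill hA sW sB (fun t => hb (eq_bot_iff.2 fun x hx => t.p0 1 h1 x hx))
  obtain ⟨k2, -⟩ := kill hA sT sW (fun t => ht (eq_top_iff.2 fun x hx => t.p0 1 h1 x hx))
  constructor
  · intro a ha h
    have : a ∈ A0 ⊓ carr W W ⊥ ⊥ := ⟨ha, h, h⟩
    rwa [k1] at this
  · intro a ha h
    have : a ∈ A0 ⊓ carr ⊤ ⊤ W W := ⟨ha, fun x _ => h x, fun x _ => h x⟩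
    rwa [k2] at this

lemma faith_dim {A0 : Submodule K (Module.End K V)} (W : Submodule K V)
    (s0 : ∀ a ∈ A0, ∀ w ∈ W, a w ∈ W) (f1 : ∀ a ∈ A0, (∀ w ∈ W, a w = 0) → a = 0)
    (f2 : ∀ a ∈ A0, (∀ x, a x ∈ W) → a = 0) :
    4 * Module.finrank K A0 ≤ Module.finrank K V * Module.finrank K V := by
  let φ : A0 →ₗ[K] Module.End K W :=
    { toFun := fun a => a.1.restrict (s0 a.1 a.2)
      map_add' := fun _ _ => rfl
      map_smul' := fun _ _ => rfl }
  let ψ : A0 →ₗ[K] Module.End K (V ⧸ W) :=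
    { toFun := fun a => W.mapQ W a.1 (s0 a.1 a.2)
      map_add' := fun _ _ => by ext; rfl
      map_smul' := fun _ _ => by ext; rfl }
  have i1 : Function.Injective φ := by
    rw [← LinearMap.ker_eq_bot, LinearMap.ker_eq_bot']
    intro a ha
    refine Subtype.ext (f1 a.1 a.2 fun w hw => ?_)
    exact congrArg Subtype.val (LinearMap.congr_fun ha ⟨w, hw⟩)
  have i2 : Function.Injective ψ := by
    rw [← LinearMap.ker_eq_bot, LinearMap.ker_eq_bot']
    intro a ha
    refine Subtype.ext (f2 a.1 a.2 fun w => ?_)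
    have := LinearMap.congr_fun ha (W.mkQ w)
    exact (Submodule.Quotient.mk_eq_zero W).1 this
  have d1 := LinearMap.finrank_le_finrank_of_injective i1
  have d2 := LinearMap.finrank_le_finrank_of_injective i2
  rw [Module.finrank_linearMap] at d1 d2
  rw [← W.finrank_quotient_add_finrank]
  exact sq_bound d2 d1

end Abs

section Abs
variable {K V : Type*} [Field K] [AddCommGroup V] [Module K V] [FiniteDimensional K V]

lemma stableW [IsAlgClosed K] [CharZero K] [Nontrivial V] {A0 A1 : Submodule K (Module.End K V)}
    (h : ND A0 A1) (hA : SClosed A0 A1) (h1 : (1 : Module.End K V) ∈ A0)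
    (hp : ¬ (A0 = ⊤ ∧ A1 = ⊤)) :
    ∃ W : Submodule K V, (∀ a ∈ A0, ∀ w ∈ W, a w ∈ W) ∧ (∀ a ∈ A1, ∀ w ∈ W, a w ∈ W) ∧
      W ≠ ⊥ ∧ W ≠ ⊤ := by
  by_contra hc
  push Not at hc
  refine hp (lemN1 h hA h1 fun W s0 s1 => ?_)
  by_cases hb : W = ⊥
  · exact Or.inl hb
  · exact Or.inr (hc W s0 s1 hb)

lemma good_of {J B : Submodule K (Module.End K V)} (hJB : J ⊔ B = ⊤) (v : V) (l : Module.Dual K V)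
    (hlv : l v = 1) (hB : ∀ b ∈ B, b v = 0 ∧ ∀ x, l (b x) = 0) : Good J v l := by
  intro w μ hw
  have : l.smulRight w + (μ - l w • l).smulRight v ∈ J ⊔ B := by rw [hJB]; trivial
  obtain ⟨b, hb, c, hc, e⟩ := Submodule.mem_sup.1 this
  have ha : ∀ x, b x = l x • w + (μ x - l w * l x) • v - c x := by
    intro x
    have := LinearMap.congr_fun e x
    rw [eq_sub_iff_add_eq]
    simpa using this
  refine ⟨b, hb, ?_, fun x => ?_⟩
  · rw [ha, (hB c hc).1, hlv, hw]; simp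
  · rw [ha, map_sub, (hB c hc).2]; simp [hlv]; ring

lemma caseC [IsAlgClosed K] [CharZero K] [Nontrivial V] {A0 A1 : Submodule K (Module.End K V)}
    (h : ND A0 A1) (hA : SSimple A0 A1) (h1 : (1 : Module.End K V) ∈ A0)
    (hp : ¬ (A0 = ⊤ ∧ A1 = ⊤)) (v : V) (l : Module.Dual K V)
    (hlv : l v = 1) (hG : Good A0 v l) : False := by
  obtain ⟨W, s0, s1, hb, ht⟩ := stableW h hA.toSClosed h1 hp
  obtain ⟨f1, f2⟩ := faith hA h1 W s0 s1 hb ht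
  rcases lemIII hA.h00 (RZ hA) v l hlv hG with ⟨μ, hμ, hm⟩ | ⟨w, hw, hm⟩
  · by_cases hW : ∃ w ∈ W, μ w ≠ 0
    · obtain ⟨w, hw, hne⟩ := hW
      have h2 := s0 _ hm w hw
      rw [LinearMap.smulRight_apply, Submodule.smul_mem_iff _ hne] at h2
      apply ht
      rw [Submodule.eq_top_iff']
      intro x
      obtain ⟨b, hb, rfl, -⟩ := hG x (l x • l) (by simp [hlv])
      exact s0 b hb v h2
    · push Not at hW
      have := f1 _ hm (fun w hw => by rw [LinearMap.smulRight_apply, hW w hw, zero_smul])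
      apply hμ
      ext x
      have h3 := congrArg l (LinearMap.congr_fun this x)
      simpa [hlv] using h3
  · by_cases hW : ∃ x ∈ W, l x ≠ 0
    · obtain ⟨x, hx, hne⟩ := hW
      have h2 := s0 _ hm x hx
      rw [LinearMap.smulRight_apply, Submodule.smul_mem_iff _ hne] at h2
      have := f2 _ hm (fun y => by rw [LinearMap.smulRight_apply]; exact W.smul_mem _ h2)
      apply hw
      have h3 := LinearMap.congr_fun this v
      simpa [hlv] using h3
    · push Not at hW
      apply hb
      rw [Submodule.eq_bot_iff]
      intro x hx
      rw [← Module.forall_dual_apply_eq_zero_iff K]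
      intro μ
      obtain ⟨b, hb, -, e⟩ := hG (μ v • v) μ (by simp [hlv])
      rw [← e]; exact hW _ (s0 b hb x hx)

lemma case2b [CharZero K] {B0 B1 : Submodule K (Module.End K V)}
    (hB : SSimple B0 B1) (hz : ∀ a ∈ B0, ∀ y ∈ B1, τ (a * y) = 0) (v : V) (l : Module.Dual K V)
    (hlv : l v = 1) (hG : Good B0 v l) (hG1 : Good B1 v l) : False := by
  rcases lemIII hB.h00 (RZ hB) v l hlv hG with ⟨μ, hμ, hm⟩ | ⟨w, hw, hm⟩
  · apply hμ
    ext x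
    obtain ⟨b, hb, rfl, -⟩ := hG1 x (l x • l) (by simp [hlv])
    have := hz _ hm b hb
    rw [τ_comm, τ_rank1] at this
    simpa using this
  · apply hw
    rw [← Module.forall_dual_apply_eq_zero_iff K]
    intro μ
    obtain ⟨b, hb, -, e⟩ := hG1 (μ v • v) μ (by simp [hlv])
    have := hz _ hm b hb
    rw [τ_comm, τ_rank1] at this
    rw [← e]; exact this

lemma sup_dim {S T : Submodule K (Module.End K V)} (h : S ⊔ T = ⊤) :
    Module.finrank K V * Module.finrank K V ≤ Module.finrank K S + Module.finrank K T := by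
  have := Submodule.finrank_add_le_finrank_add_finrank S T
  rwa [h, finrank_top, Module.finrank_linearMap] at this

lemma zero_dim {S T : Submodule K (Module.End K V)} (hz : ∀ a ∈ S, ∀ y ∈ T, τ (a * y) = 0) :
    Module.finrank K S + Module.finrank K T ≤ Module.finrank K V * Module.finrank K V := by
  have h1 := finrank_perp S
  rw [Module.finrank_linearMap] at h1
  have h2 : T ≤ perp S := fun y hy => mem_perp.2 fun s hs => by rw [τ_comm]; exact hz s hs y hy
  have := Submodule.finrank_mono h2
  omega

lemma case2 [IsAlgClosed K] [CharZero K] [Nontrivial V] {A0 A1 B0 B1 : Submodule K (Module.End K V)}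
    (hA : SSimple A0 A1) (hB : SSimple B0 B1) (h : ND A0 A1)
    (hz : ∀ a ∈ B0, ∀ y ∈ B1, τ (a * y) = 0) (hp : ¬ (A0 = ⊤ ∧ A1 = ⊤))
    (e0 : A0 ⊔ B0 = ⊤) (e1 : A1 ⊔ B1 = ⊤) : False := by
  obtain ⟨p, hpA, p0, p1⟩ := h.unit hA.toSClosed
  by_cases hp1 : p = 1
  · rw [hp1] at hpA
    obtain ⟨W, s0, s1, hb, ht⟩ := stableW h hA.toSClosed hpA hp
    obtain ⟨f1, f2⟩ := faith hA hpA W s0 s1 hb ht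
    have d := faith_dim W s0 f1 f2
    have d1 := h.finrank_eq
    have d2 := sup_dim e0
    have d3 := sup_dim e1
    have d4 := zero_dim hz
    have d5 : 0 < Module.finrank K V * Module.finrank K V :=
      Nat.mul_pos Module.finrank_pos Module.finrank_pos
    omega
  · obtain ⟨v, l, hlv, hpv, hlp⟩ := idem_vec p (p0 p hpA).1 hp1
    have key : ∀ b : Module.End K V, p * b = b ∧ b * p = b → b v = 0 ∧ ∀ x, l (b x) = 0 := by
      rintro b ⟨h1, h2⟩
      constructor
      · rw [← h2, Module.End.mul_apply, hpv, map_zero]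
      · intro x; rw [← h1, Module.End.mul_apply, hlp]
    exact case2b hB hz v l hlv
      (good_of (by rw [sup_comm]; exact e0) v l hlv fun b hb => key b (p0 b hb))
      (good_of (by rw [sup_comm]; exact e1) v l hlv fun b hb => key b (p1 b hb))

lemma case3unit [CharZero K] {A0 A1 : Submodule K (Module.End K V)} (hA : SSimple A0 A1)
    (hn : 2 ≤ Module.finrank K V) (hperp : A1 = perp A0) : (1 : Module.End K V) ∈ A0 := by
  obtain ⟨g, hg, hg2⟩ := exists_unit hA.h00 (RZ hA)
  by_cases hg1 : g = 1
  · rwa [← hg1]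
  exfalso
  obtain ⟨v, l, hlv, hpv, hlp⟩ := idem_vec g (hg2 g hg).1 hg1
  have kv : ∀ a ∈ A0, a v = 0 := fun a ha => by
    rw [← (hg2 a ha).2, Module.End.mul_apply, hpv, map_zero]
  have kl : ∀ a ∈ A0, ∀ x, l (a x) = 0 := fun a ha x => by
    rw [← (hg2 a ha).1, Module.End.mul_apply, hlp]
  have m1 : ∀ μ : Module.Dual K V, μ.smulRight v ∈ A1 := by
    intro μ
    rw [hperp, mem_perp]
    intro s hs
    rw [τ_comm, τ_rank1, kv s hs, map_zero]
  have m2 : ∀ w : V, l.smulRight w ∈ A1 := by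
    intro w
    rw [hperp, mem_perp]
    intro s hs
    rw [τ_comm, τ_rank1, kl s hs]
  have hw : ∃ w, w - l w • v ≠ 0 := by
    by_contra hc
    push Not at hc
    have := finrank_le_one (R := K) v (fun w => ⟨l w, (sub_eq_zero.1 (hc w)).symm⟩)
    omega
  obtain ⟨w, hw⟩ := hw
  set u := w - l w • v with hu
  obtain ⟨ν, hν⟩ : ∃ ν : Module.Dual K V, ν u ≠ 0 := by
    by_contra hc
    push Not at hc
    exact hw ((Module.forall_dual_apply_eq_zero_iff K _).1 hc)
  have hlu : l u = 0 := by simp [hu, hlv]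
  have := kv _ (hA.h11 _ (m1 (ν - ν v • l)) _ (m2 u))
  simp [hlv, hlu] at this
  rcases this with h | h
  · exact hν h
  · rw [h] at hlv; simp at hlv

theorem abs_main [IsAlgClosed K] [CharZero K] {A0 A1 B0 B1 : Submodule K (Module.End K V)}
    (hn : 2 ≤ Module.finrank K V)
    (hA : SSimple A0 A1) (hB : SSimple B0 B1) (hp : ¬ (A0 = ⊤ ∧ A1 = ⊤)) (hq : ¬ (B0 = ⊤ ∧ B1 = ⊤))
    (e0 : A0 ⊔ B0 = ⊤) (e1 : A1 ⊔ B1 = ⊤) : False := by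
  have hnt : Nontrivial V := Module.nontrivial_of_finrank_pos (R := K) (by omega)
  have e0' : B0 ⊔ A0 = ⊤ := by rw [sup_comm]; exact e0
  have e1' : B1 ⊔ A1 = ⊤ := by rw [sup_comm]; exact e1
  have d5 : 0 < Module.finrank K V * Module.finrank K V :=
      Nat.mul_pos Module.finrank_pos Module.finrank_pos
  rcases form_dich hA with a | a <;> rcases form_dich hB with b | b
  · obtain ⟨p, hpA, p0, p1⟩ := a.unit hA.toSClosed
    obtain ⟨q, hqB, q0, q1⟩ := b.unit hB.toSClosed
    have key : ∀ (p b : Module.End K V) (v : V) (l : Module.Dual K V), p v = 0 →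
        (∀ x, l (p x) = 0) → p * b = b ∧ b * p = b → b v = 0 ∧ ∀ x, l (b x) = 0 := by
      rintro p b v l hpv hlp ⟨h1, h2⟩
      constructor
      · rw [← h2, Module.End.mul_apply, hpv, map_zero]
      · intro x; rw [← h1, Module.End.mul_apply, hlp]
    by_cases hp1 : p = 1
    · rw [hp1] at hpA
      by_cases hq1 : q = 1
      · rw [hq1] at hqB
        obtain ⟨W, s0, s1, hb, ht⟩ := stableW a hA.toSClosed hpA hp
        obtain ⟨f1, f2⟩ := faith hA hpA W s0 s1 hb ht
        have d := faith_dim W s0 f1 f2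
        obtain ⟨W', s0', s1', hb', ht'⟩ := stableW b hB.toSClosed hqB hq
        obtain ⟨f1', f2'⟩ := faith hB hqB W' s0' s1' hb' ht'
        have d' := faith_dim W' s0' f1' f2'
        have d2 := sup_dim e0
        omega
      · obtain ⟨v, l, hlv, hpv, hlp⟩ := idem_vec q (q0 q hqB).1 hq1
        exact caseC a hA hpA hp v l hlv
          (good_of e0 v l hlv fun b hb => key q b v l hpv hlp (q0 b hb))
    · obtain ⟨v, l, hlv, hpv, hlp⟩ := idem_vec p (p0 p hpA).1 hp1
      by_cases hq1 : q = 1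
      · rw [hq1] at hqB
        exact caseC b hB hqB hq v l hlv
          (good_of e0' v l hlv fun b hb => key p b v l hpv hlp (p0 b hb))
      · obtain ⟨v', l', hlv', hpv', hlp'⟩ := idem_vec q (q0 q hqB).1 hq1
        obtain ⟨x, hx⟩ : ∃ x : Module.End K V, l' (x v) ≠ 0 :=
          ⟨l.smulRight v', by simp [hlv, hlv']⟩
        have : x ∈ A0 ⊔ B0 := by rw [e0]; trivial
        obtain ⟨y, hy, z, hz, rfl⟩ := Submodule.mem_sup.1 this
        apply hx
        rw [LinearMap.add_apply, map_add, (key p y v l hpv hlp (p0 y hy)).1,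
          (key q z v' l' hpv' hlp' (q0 z hz)).2, map_zero, add_zero]
  · exact case2 hA hB a b hp e0 e1
  · exact case2 hB hA b a hq e0' e1'
  · have d1 := sup_dim e0
    have d2 := sup_dim e1
    have d3 := zero_dim a
    have d4 := zero_dim b
    have pp : ∀ S T : Submodule K (Module.End K V), (∀ a ∈ S, ∀ y ∈ T, τ (a * y) = 0) →
        Module.finrank K S + Module.finrank K T = Module.finrank K V * Module.finrank K V →
        T = perp S := by
      intro S T hz hd
      have h1 := finrank_perp S
      rw [Module.finrank_linearMap] at h1
      exact Submodule.eq_of_le_of_finrank_eq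
        (fun y hy => mem_perp.2 fun s hs => by rw [τ_comm]; exact hz s hs y hy) (by omega)
    have u1 := case3unit hA hn (pp A0 A1 a (by omega))
    have u2 := case3unit hB hn (pp B0 B1 b (by omega))
    have hi := Submodule.finrank_sup_add_finrank_inf_eq A0 B0
    rw [e0, finrank_top, Module.finrank_linearMap] at hi
    have hi0 : Module.finrank K ↥(A0 ⊓ B0) = 0 := by omega
    rw [Submodule.finrank_eq_zero] at hi0
    have h1 : (1 : Module.End K V) ∈ A0 ⊓ B0 := ⟨u1, u2⟩
    rw [hi0] at h1
    exact one_ne_zero ((Submodule.mem_bot K).1 h1)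

end Abs

section Transfer
variable {F : Type*} [Field F] {n : ℕ}

/-- even embedding -/
noncomputable def phi : Module.End F (Fin n → F) →ₗ[F] MJ F n n where
  toFun a := Matrix.fromBlocks (LinearMap.toMatrix' a) 0 0 (LinearMap.toMatrix' a)
  map_add' a b := by simp [Matrix.fromBlocks_add]
  map_smul' c a := by simp [Matrix.fromBlocks_smul]

/-- odd embedding -/
noncomputable def psi : Module.End F (Fin n → F) →ₗ[F] MJ F n n where
  toFun a := Matrix.fromBlocks 0 (LinearMap.toMatrix' a) (LinearMap.toMatrix' a) 0
  map_add' a b := by simp [Matrix.fromBlocks_add]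
  map_smul' c a := by simp [Matrix.fromBlocks_smul]

lemma odd_phi (a : Module.End F (Fin n → F)) : oddPart F (phi a) = 0 := by
  ext (i | i) (j | j) <;> simp [oddPart, phi, pty]

lemma odd_psi (a : Module.End F (Fin n → F)) : oddPart F (psi a) = psi a := by
  ext (i | i) (j | j) <;> simp [oddPart, psi, pty]

lemma phi_even (a : Module.End F (Fin n → F)) : phi a ∈ evenSub F n n := by
  rintro (i | i) (j | j) h <;> simp_all [phi, pty]

lemma psi_odd (a : Module.End F (Fin n → F)) : psi a ∈ oddSub F n n := by
  rintro (i | i) (j | j) h <;> simp_all [psi, pty]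

lemma oddPart_add {m : ℕ} (X Y : MJ F n m) : oddPart F (X + Y) = oddPart F X + oddPart F Y := by
  ext i j
  simp only [oddPart, Matrix.of_apply, Matrix.add_apply]
  split_ifs <;> simp

lemma jmul_add_left {m : ℕ} (X Y Z : MJ F n m) : jmul (X + Y) Z = jmul X Z + jmul Y Z := by
  simp only [jmul, oddPart_add, add_mul, mul_add, smul_add]
  abel

lemma jmul_add_right {m : ℕ} (X Y Z : MJ F n m) : jmul Z (X + Y) = jmul Z X + jmul Z Y := by
  simp only [jmul, oddPart_add, add_mul, mul_add, smul_add]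
  abel

lemma phi_mul (a b : Module.End F (Fin n → F)) : phi a * phi b = phi (a * b) := by
  simp [phi, Matrix.fromBlocks_multiply, LinearMap.toMatrix'_mul]

lemma phi_psi (a b : Module.End F (Fin n → F)) : phi a * psi b = psi (a * b) := by
  simp [phi, psi, Matrix.fromBlocks_multiply, LinearMap.toMatrix'_mul]

lemma psi_phi (a b : Module.End F (Fin n → F)) : psi a * phi b = psi (a * b) := by
  simp [phi, psi, Matrix.fromBlocks_multiply, LinearMap.toMatrix'_mul]

lemma psi_mul (a b : Module.End F (Fin n → F)) : psi a * psi b = phi (a * b) := by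
  simp [phi, psi, Matrix.fromBlocks_multiply, LinearMap.toMatrix'_mul]

lemma j00 (a b : Module.End F (Fin n → F)) :
    jmul (phi a) (phi b) = phi ((2 : F)⁻¹ • (a * b + b * a)) := by
  simp [jmul, odd_phi, phi_mul]

lemma j01 (a b : Module.End F (Fin n → F)) :
    jmul (phi a) (psi b) = psi ((2 : F)⁻¹ • (a * b + b * a)) := by
  simp [jmul, odd_phi, phi_psi, psi_phi]

lemma j10 (a b : Module.End F (Fin n → F)) :
    jmul (psi a) (phi b) = psi ((2 : F)⁻¹ • (a * b + b * a)) := by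
  simp [jmul, odd_phi, phi_psi, psi_phi]

lemma j11 [CharZero F] (a b : Module.End F (Fin n → F)) :
    jmul (psi a) (psi b) = phi ((2 : F)⁻¹ • (a * b - b * a)) := by
  simp only [jmul, odd_psi, psi_mul, ← map_add, ← map_smul, ← map_sub]
  congr 1
  have : b * a = (2 : F)⁻¹ • (b * a + b * a) := by
    rw [← two_smul F (b * a), smul_smul, inv_mul_cancel₀ two_ne_zero, one_smul]
  nth_rewrite 2 [this]
  refine (smul_sub (2 : F)⁻¹ _ _).symm.trans ?_
  congr 1
  abel

lemma decomp_inj {a b a' b' : Module.End F (Fin n → F)} (h : phi a + psi b = phi a' + psi b') :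
    a = a' ∧ b = b' := by
  simp only [phi, psi, LinearMap.coe_mk, AddHom.coe_mk, Matrix.fromBlocks_add, add_zero, zero_add,
    Matrix.fromBlocks_inj] at h
  exact ⟨LinearMap.toMatrix'.injective h.1, LinearMap.toMatrix'.injective h.2.1⟩

lemma mem_Q (a b : Module.End F (Fin n → F)) : phi a + psi b ∈ QSub F n := by
  constructor <;> intro i j <;> simp [phi, psi]

lemma exists_decomp {X : MJ F n n} (h : X ∈ QSub F n) : ∃ a b, X = phi a + psi b := by
  refine ⟨Matrix.toLin' X.toBlocks₁₁, Matrix.toLin' X.toBlocks₁₂, ?_⟩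
  obtain ⟨h1, h2⟩ := h
  ext (i | i) (j | j) <;>
    simp [phi, psi, Matrix.toBlocks₁₁, Matrix.toBlocks₁₂, h1, h2]

lemma even_decomp {X : MJ F n n} (h : X ∈ QSub F n) (he : X ∈ evenSub F n n) : ∃ a, X = phi a := by
  obtain ⟨a, b, rfl⟩ := exists_decomp h
  refine ⟨a, ?_⟩
  have h2 : psi b ∈ evenSub F n n := by
    have := sub_mem he (phi_even a)
    simpa using this
  have : psi b = 0 := by
    ext i j
    by_cases hij : pty i = pty j
    · exact psi_odd b i j hij
    · exact h2 i j hij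
  rw [this, add_zero]

lemma odd_decomp {X : MJ F n n} (h : X ∈ QSub F n) (he : X ∈ oddSub F n n) : ∃ a, X = psi a := by
  obtain ⟨a, b, rfl⟩ := exists_decomp h
  refine ⟨b, ?_⟩
  have h2 : phi a ∈ oddSub F n n := by
    have := sub_mem he (psi_odd b)
    simpa using this
  have : phi a = 0 := by
    ext i j
    by_cases hij : pty i = pty j
    · exact h2 i j hij
    · exact phi_even a i j hij
  rw [this, zero_add]

lemma graded_decomp {A : Submodule F (MJ F n n)} (hQ : A ≤ QSub F n) (hg : IsGraded F A)
    {X : MJ F n n} (hX : X ∈ A) :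
    ∃ a ∈ A.comap phi, ∃ b ∈ A.comap psi, X = phi a + psi b := by
  have h2 : X ∈ (A ⊓ evenSub F n n) ⊔ (A ⊓ oddSub F n n) := by
    have : A = _ := hg
    rw [← this]; exact hX
  obtain ⟨y, hy, z, hz, rfl⟩ := Submodule.mem_sup.1 h2
  obtain ⟨a, rfl⟩ := even_decomp (hQ hy.1) hy.2
  obtain ⟨b, rfl⟩ := odd_decomp (hQ hz.1) hz.2
  exact ⟨a, hy.1, b, hz.1, rfl⟩

lemma unhalf [CharZero F] {S : Submodule F (Module.End F (Fin n → F))} {x : Module.End F (Fin n → F)}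
    (h : (2 : F)⁻¹ • x ∈ S) : x ∈ S := by
  rwa [Submodule.smul_mem_iff _ (inv_ne_zero two_ne_zero)] at h

lemma transfer [CharZero F] {A : Submodule F (MJ F n n)} (hQ : A ≤ QSub F n) (hs : IsSubalg F A)
    (hsim : IsSimple F A) : SSimple (A.comap phi) (A.comap psi) := by
  obtain ⟨hg, hm⟩ := hs
  obtain ⟨⟨x, hx, y, hy, hxy⟩, hid⟩ := hsim
  refine { h00 := ?_, h01 := ?_, h11 := ?_, ideal := ?_, nz := ?_ }
  · intro a ha b hb
    have := hm _ ha _ hb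
    rw [j00] at this
    exact unhalf (S := A.comap phi) this
  · intro a ha b hb
    have := hm _ ha _ hb
    rw [j01] at this
    exact unhalf (S := A.comap psi) this
  · intro a ha b hb
    have := hm _ ha _ hb
    rw [j11] at this
    exact unhalf (S := A.comap phi) this
  · intro I0 I1 l0 l1 i00 i01 i10 i11
    have hI := hid (I0.map phi ⊔ I1.map psi)
      (sup_le (Submodule.map_le_iff_le_comap.2 l0) (Submodule.map_le_iff_le_comap.2 l1)) ?_ ?_
    · have mem : ∀ a b, phi a + psi b ∈ I0.map phi ⊔ I1.map psi → a ∈ I0 ∧ b ∈ I1 := by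
        intro a b h
        obtain ⟨_, ⟨a', ha', rfl⟩, _, ⟨b', hb', rfl⟩, e⟩ := Submodule.mem_sup.1 h
        obtain ⟨rfl, rfl⟩ := decomp_inj e
        exact ⟨ha', hb'⟩
      rcases hI with h | h
      · left
        constructor
        · rw [Submodule.eq_bot_iff]
          intro a ha
          have : phi a ∈ I0.map phi ⊔ I1.map psi := Submodule.mem_sup_left ⟨a, ha, rfl⟩
          rw [h, Submodule.mem_bot] at this
          exact (decomp_inj (b := 0) (b' := 0) (a' := 0) (by simp [this])).1
        · rw [Submodule.eq_bot_iff]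
          intro a ha
          have : psi a ∈ I0.map phi ⊔ I1.map psi := Submodule.mem_sup_right ⟨a, ha, rfl⟩
          rw [h, Submodule.mem_bot] at this
          exact (decomp_inj (a := 0) (b' := 0) (a' := 0) (by simp [this])).2
      · right
        constructor
        · apply le_antisymm l0
          intro a ha
          refine (mem a 0 ?_).1
          rw [h, map_zero, add_zero]; exact ha
        · apply le_antisymm l1
          intro a ha
          refine (mem 0 a ?_).2
          rw [h, map_zero, zero_add]; exact ha
    · apply le_antisymm
      · apply sup_le
        · refine le_sup_of_le_left (le_inf le_sup_left ?_)
          rintro _ ⟨a, _, rfl⟩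
          exact phi_even a
        · refine le_sup_of_le_right (le_inf le_sup_right ?_)
          rintro _ ⟨a, _, rfl⟩
          exact psi_odd a
      · exact sup_le inf_le_left inf_le_left
    · intro x hx y hy
      obtain ⟨a, ha, b, hb, rfl⟩ := graded_decomp hQ hg hx
      obtain ⟨_, ⟨a', ha', rfl⟩, _, ⟨b', hb', rfl⟩, rfl⟩ := Submodule.mem_sup.1 hy
      rw [jmul_add_left, jmul_add_right, jmul_add_right, j00, j01, j10, j11]
      refine add_mem (add_mem ?_ ?_) (add_mem ?_ ?_)
      · exact Submodule.mem_sup_left ⟨_, I0.smul_mem _ (i00 a ha a' ha'), rfl⟩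
      · exact Submodule.mem_sup_right ⟨_, I1.smul_mem _ (i01 a ha b' hb'), rfl⟩
      · exact Submodule.mem_sup_right ⟨_, I1.smul_mem _ (i10 b hb a' ha'), rfl⟩
      · exact Submodule.mem_sup_left ⟨_, I0.smul_mem _ (i11 b hb b' hb'), rfl⟩
  · rintro ⟨z0, z1, z2⟩
    apply hxy
    obtain ⟨a, ha, b, hb, rfl⟩ := graded_decomp hQ hg hx
    obtain ⟨a', ha', b', hb', rfl⟩ := graded_decomp hQ hg hy
    rw [jmul_add_left, jmul_add_right, jmul_add_right, j00, j01, j10, j11, z0 a ha a' ha',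
      z1 a ha b' hb', add_comm (b * a') _, z1 a' ha' b hb, z2 b hb b' hb']
    simp

lemma proper_transfer {A : Submodule F (MJ F n n)} (hQ : A ≤ QSub F n) (hne : A ≠ QSub F n) :
    ¬ (A.comap phi = ⊤ ∧ A.comap psi = ⊤) := by
  rintro ⟨h0, h1⟩
  apply hne
  apply le_antisymm hQ
  intro X hX
  obtain ⟨a, b, rfl⟩ := exists_decomp hX
  have ha : a ∈ A.comap phi := by rw [h0]; trivial
  have hb : b ∈ A.comap psi := by rw [h1]; trivial
  exact add_mem ha hb

lemma sup_transfer {A B : Submodule F (MJ F n n)} (hA : A ≤ QSub F n) (hB : B ≤ QSub F n)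
    (gA : IsGraded F A) (gB : IsGraded F B) (h : A ⊔ B = QSub F n) :
    A.comap phi ⊔ B.comap phi = ⊤ ∧ A.comap psi ⊔ B.comap psi = ⊤ := by
  have key : ∀ a b, a ∈ A.comap phi ⊔ B.comap phi ∧ b ∈ A.comap psi ⊔ B.comap psi := by
    intro a b
    have := mem_Q (F := F) (n := n) a b
    rw [← h] at this
    obtain ⟨x, hx, y, hy, e⟩ := Submodule.mem_sup.1 this
    obtain ⟨a1, ha1, b1, hb1, rfl⟩ := graded_decomp hA gA hx
    obtain ⟨a2, ha2, b2, hb2, rfl⟩ := graded_decomp hB gB hy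
    have e2 : phi (a1 + a2) + psi (b1 + b2) = phi a + psi b := by
      rw [← e, map_add, map_add]; abel
    obtain ⟨rfl, rfl⟩ := decomp_inj e2
    exact ⟨add_mem (Submodule.mem_sup_left ha1) (Submodule.mem_sup_right ha2),
      add_mem (Submodule.mem_sup_left hb1) (Submodule.mem_sup_right hb2)⟩
  exact ⟨Submodule.eq_top_iff'.2 fun a => (key a 0).1, Submodule.eq_top_iff'.2 fun b => (key 0 b).2⟩

end Transfer
/-- for `F` algebraically closed of characteristic zero and `n ≥ 2`, the
Jordan superalgebra `Q(n)` cannot be written as `A + B` for two proper nontrivial simple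
subsuperalgebras `A` and `B`. -/
theorem no_simple_decomposition_Q
    (F : Type*) [Field F] [IsAlgClosed F] [CharZero F]
    (n : ℕ) (hn : 2 ≤ n) :
    ¬ ∃ A B : Submodule F (MJ F n n),
        A ≤ QSub F n ∧ B ≤ QSub F n ∧
        IsSubalg F A ∧ IsSubalg F B ∧
        A ≠ QSub F n ∧ B ≠ QSub F n ∧
        Nontriv F A ∧ Nontriv F B ∧
        IsSimple F A ∧ IsSimple F B ∧
        A ⊔ B = QSub F n := by
  rintro ⟨A, B, qA, qB, sA, sB, nA, nB, -, -, iA, iB, hAB⟩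
  obtain ⟨e0, e1⟩ := sup_transfer qA qB sA.1 sB.1 hAB
  exact abs_main (by simpa using hn) (transfer qA sA iA) (transfer qB sB iB)
    (proper_transfer qA nA) (proper_transfer qB nB) e0 e1

end SJ
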